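/- Let S ⊆ ℂ^N be a Zariski-locally-closed irreducible subset that is smooth of complex dimension m ≥ 1, and let (f,g) be an algebraic family of pairs of rational maps of degree d ≥ 2 over S that is maximally non-isotrivial. Then for each integer ℓ with 1 ≤ ℓ ≤ m, the set {(s, x_1, …, x_ℓ) ∈ S × (ℙ¹(ℂ))^ℓ : x_i ∈ Preper(f_s) ∩ Preper(g_s) for each i} is Zariski dense in S × (ℙ¹(ℂ))^ℓ. -/

import Mathlib

noncomputable section

open MvPolynomial

abbrev P1 : Type := Projectivization ℂ (Fin 2 → ℂ)

lemma vec_ne {p q : ℂ} (h : p ≠ 0 ∨ q ≠ 0) : ![p, q] ≠ 0 := by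
  intro hz
  rcases h with h | h
  · exact h (by simpa using congrFun hz 0)
  · exact h (by simpa using congrFun hz 1)

/-- Evaluation at `v ∈ ℂ²` of the homogeneous degree-`d` form `∑ⱼ aⱼ Xʲ Y^(d-j)`
whose coefficient tuple is `a`. -/
def homEval {d : ℕ} (a : Fin (d + 1) → ℂ) (v : Fin 2 → ℂ) : ℂ :=
  ∑ j : Fin (d + 1), a j * v 0 ^ (j : ℕ) * v 1 ^ (d - (j : ℕ))

/-- The pair of degree-`d` forms with coefficient tuples `a`, `b` has no common zero
in `ℂ² \ {0}`. -/
def GoodPair {d : ℕ} (a b : Fin (d + 1) → ℂ) : Prop :=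
  ∀ v : Fin 2 → ℂ, v ≠ 0 → homEval a v ≠ 0 ∨ homEval b v ≠ 0

open Classical in
/-- The self-map of `ℙ¹(ℂ)` induced by the pair of degree-`d` forms with coefficient
tuples `a`, `b` (defined arbitrarily where both forms vanish, which does not happen
for a `GoodPair`). -/
def ratFun {d : ℕ} (a b : Fin (d + 1) → ℂ) (x : P1) : P1 :=
  if h : homEval a x.rep ≠ 0 ∨ homEval b x.rep ≠ 0 then
    Projectivization.mk ℂ ![homEval a x.rep, homEval b x.rep] (vec_ne h)
  else x

/-- A rational map of degree `d` on `ℙ¹(ℂ)`: a pair of homogeneous degree-`d` forms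
(recorded through their coefficient tuples) with no common zero in `ℂ² \ {0}`. -/
structure RatMap (d : ℕ) where
  a : Fin (d + 1) → ℂ
  b : Fin (d + 1) → ℂ
  good : GoodPair a b

/-- The self-map of `ℙ¹(ℂ)` induced by a rational map. -/
def RatMap.toFun {d : ℕ} (f : RatMap d) : P1 → P1 := ratFun f.a f.b

/-- The set of preperiodic points of a rational map of degree `d` on `ℙ¹(ℂ)`. -/
def Preper {d : ℕ} (f : RatMap d) : Set P1 :=
  {x | ∃ n m : ℕ, m < n ∧ f.toFun^[n] x = f.toFun^[m] x}

/-- The point `[z : 1]` of `ℙ¹(ℂ)`. -/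
def toP1 (z : ℂ) : P1 := Projectivization.mk ℂ ![z, 1] (vec_ne (Or.inr one_ne_zero))

/-- The point `∞ = [1 : 0]` of `ℙ¹(ℂ)`. -/
def infty : P1 := Projectivization.mk ℂ ![1, 0] (vec_ne (Or.inl one_ne_zero))

/-- The Möbius transformation of `ℙ¹(ℂ)` induced by an invertible linear map of `ℂ²`. -/
def mobius (M : (Fin 2 → ℂ) ≃ₗ[ℂ] (Fin 2 → ℂ)) (x : P1) : P1 :=
  Projectivization.mk ℂ (M x.rep) (by
    simpa using (LinearEquiv.map_ne_zero_iff M).mpr x.rep_nonzero)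
/-- A Zariski-closed subset of `ℂ^N`: the common zero locus of finitely many
polynomials. -/
def ZarClosedAff {N : ℕ} (Z : Set (Fin N → ℂ)) : Prop :=
  ∃ I : Finset (MvPolynomial (Fin N) ℂ), Z = {s | ∀ p ∈ I, eval s p = 0}

/-- A Zariski-locally-closed subset of `ℂ^N`: the difference of two Zariski-closed
sets (equivalently, the intersection of a Zariski-closed and a Zariski-open set). -/
def ZarLocallyClosed {N : ℕ} (S : Set (Fin N → ℂ)) : Prop :=
  ∃ Z W : Set (Fin N → ℂ), ZarClosedAff Z ∧ ZarClosedAff W ∧ S = Z \ W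

/-- Zariski irreducibility of a subset of `ℂ^N`. -/
def ZarIrreducible {N : ℕ} (S : Set (Fin N → ℂ)) : Prop :=
  S.Nonempty ∧ ∀ Z₁ Z₂ : Set (Fin N → ℂ), ZarClosedAff Z₁ → ZarClosedAff Z₂ →
    S ⊆ Z₁ ∪ Z₂ → (S ⊆ Z₁ ∨ S ⊆ Z₂)

/-- `S` is, near `s`, a complex submanifold of `ℂ^N` of complex dimension `m`:
there are an open set `U ∋ s` and a holomorphic homeomorphism-onto-its-image
`φ` with injective differential from an open subset of `ℂ^m` onto `S ∩ U`. -/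
def SmoothChartAt {N : ℕ} (S : Set (Fin N → ℂ)) (m : ℕ) (s : Fin N → ℂ) : Prop :=
  ∃ U : Set (Fin N → ℂ), IsOpen U ∧ s ∈ U ∧
    ∃ (V : Set (Fin m → ℂ)) (φ : (Fin m → ℂ) → Fin N → ℂ),
      IsOpen V ∧ AnalyticOnNhd ℂ φ V ∧ Set.InjOn φ V ∧ φ '' V = S ∩ U ∧
      (∀ v ∈ V, Function.Injective (fderiv ℂ φ v)) ∧
      ∃ ψ : (Fin N → ℂ) → Fin m → ℂ, ContinuousOn ψ (S ∩ U) ∧ ∀ v ∈ V, ψ (φ v) = v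

/-- `S` is a smooth complex submanifold of `ℂ^N` of pure complex dimension `m`. -/
def SmoothOfDim {N : ℕ} (S : Set (Fin N → ℂ)) (m : ℕ) : Prop :=
  ∀ s ∈ S, SmoothChartAt S m s

/-- The member of an algebraic family of rational maps of degree `d` over a base inside
`ℂ^N` at the parameter `s`: the coefficient tuples of the two degree-`d` forms are given
by the polynomials `A j`, `B j` evaluated at `s`. -/
def famMap {N d : ℕ} (A B : Fin (d + 1) → MvPolynomial (Fin N) ℂ) (s : Fin N → ℂ) :
    P1 → P1 :=
  ratFun (fun j => eval s (A j)) (fun j => eval s (B j))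

/-- The preperiodic points of the member at parameter `s` of an algebraic family of
rational maps. -/
def famPreper {N d : ℕ} (A B : Fin (d + 1) → MvPolynomial (Fin N) ℂ) (s : Fin N → ℂ) :
    Set P1 :=
  {x | ∃ n m : ℕ, m < n ∧ (famMap A B s)^[n] x = (famMap A B s)^[m] x}

/-- Evaluation of the variables indexed by `Fin N ⊕ (Fin ℓ × Fin 2)` at a point of
`ℂ^N × (ℙ¹(ℂ))^ℓ`: affine coordinates on the first factor, homogeneous coordinates
(of the chosen representatives) on each `ℙ¹` factor. -/
def ambEval {N ℓ : ℕ} (p : (Fin N → ℂ) × (Fin ℓ → P1)) :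
    Sum (Fin N) (Fin ℓ × Fin 2) → ℂ :=
  Sum.elim p.1 fun q => (p.2 q.1).rep q.2

/-- A polynomial in the affine coordinates of `ℂ^N` and the `ℓ` pairs of homogeneous
coordinates which is homogeneous in each pair of homogeneous coordinates. -/
def MultiHomog {N ℓ : ℕ} (Φ : MvPolynomial (Sum (Fin N) (Fin ℓ × Fin 2)) ℂ) : Prop :=
  ∀ i : Fin ℓ, ∃ h : ℕ, ∀ mo ∈ Φ.support,
    mo (Sum.inr (i, 0)) + mo (Sum.inr (i, 1)) = h

/-- A Zariski-closed subset of `ℂ^N × (ℙ¹(ℂ))^ℓ`: the common zero locus of finitely many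
functions polynomial in the affine coordinates of `ℂ^N` and homogeneous in each of the
`ℓ` pairs of homogeneous coordinates of `ℙ¹`. -/
def ZarClosedProd {N ℓ : ℕ} (Z : Set ((Fin N → ℂ) × (Fin ℓ → P1))) : Prop :=
  ∃ I : Finset (MvPolynomial (Sum (Fin N) (Fin ℓ × Fin 2)) ℂ),
    (∀ Φ ∈ I, MultiHomog Φ) ∧ Z = {p | ∀ Φ ∈ I, eval (ambEval p) Φ = 0}

/-- `T` is Zariski dense in `S × (ℙ¹(ℂ))^ℓ`: the only Zariski-closed subset of the
ambient space containing `T` contains all of `S × (ℙ¹(ℂ))^ℓ`. -/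
def ZarDenseIn {N ℓ : ℕ} (S : Set (Fin N → ℂ))
    (T : Set ((Fin N → ℂ) × (Fin ℓ → P1))) : Prop :=
  ∀ Z : Set ((Fin N → ℂ) × (Fin ℓ → P1)), ZarClosedProd Z → T ⊆ Z →
    ∀ p : (Fin N → ℂ) × (Fin ℓ → P1), p.1 ∈ S → p ∈ Z


theorem nullst {k R : Type*} [Field k] [IsAlgClosed k] [CommRing R] [Nontrivial R] [Algebra k R]
    [Algebra.FiniteType k R] : Nonempty (R →ₐ[k] k) := by
  obtain ⟨m, hm⟩ := Ideal.exists_maximal R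
  let := Ideal.Quotient.field m
  have := finite_of_finite_type_of_isJacobsonRing k (R ⧸ m)
  have hb : Function.Bijective (algebraMap k (R ⧸ m)) :=
    IsAlgClosed.algebraMap_bijective_of_isIntegral
  let e : k ≃ₐ[k] (R ⧸ m) := AlgEquiv.ofBijective (Algebra.ofId k (R ⧸ m)) hb
  exact ⟨e.symm.toAlgHom.comp (Ideal.Quotient.mkₐ k m)⟩

theorem nullst_ne {k R : Type*} [Field k] [IsAlgClosed k] [CommRing R] [IsDomain R] [Algebra k R]
    [Algebra.FiniteType k R] (a : R) (ha : a ≠ 0) : ∃ χ : R →ₐ[k] k, χ a ≠ 0 := by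
  have h0 : Submonoid.powers a ≤ nonZeroDivisors R := powers_le_nonZeroDivisors_of_noZeroDivisors ha
  have : Nontrivial (Localization.Away a) :=
    (IsLocalization.injective (Localization.Away a) h0).nontrivial
  have : Algebra.FiniteType R (Localization.Away a) :=
    inferInstance
  have : Algebra.FiniteType k (Localization.Away a) := Algebra.FiniteType.trans ‹_› this
  obtain ⟨χ⟩ := nullst (k := k) (R := Localization.Away a)
  refine ⟨χ.comp (IsScalarTower.toAlgHom k R _), ?_⟩
  have h1 : IsUnit (algebraMap R (Localization.Away a) a) :=
    IsLocalization.Away.algebraMap_isUnit a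
  exact (h1.map χ).ne_zero

theorem nullst_unit {k R : Type*} [Field k] [IsAlgClosed k] [CommRing R] [Algebra k R]
    [Algebra.FiniteType k R] (a : R) (ha : ∀ χ : R →ₐ[k] k, χ a ≠ 0) : IsUnit a := by
  by_contra h
  obtain ⟨m, hm, ham⟩ := exists_max_ideal_of_mem_nonunits h
  obtain ⟨χ⟩ := nullst (k := k) (R := R ⧸ m)
  refine ha (χ.comp (Ideal.Quotient.mkₐ k m)) ?_
  have : Ideal.Quotient.mkₐ k m a = 0 := by
    simpa using Ideal.Quotient.eq_zero_iff_mem.mpr ham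
  simp only [AlgHom.comp_apply, this, map_zero]

theorem chev {B A : Type*} [CommRing B] [CommRing A] [IsDomain B] [IsDomain A] [IsNoetherianRing B]
    [Algebra ℂ B] [Algebra ℂ A] [Algebra.FiniteType ℂ A]
    (φ : B →ₐ[ℂ] A) (hφ : Function.Injective φ) :
    ∃ b : B, b ≠ 0 ∧ ∀ χ : B →ₐ[ℂ] ℂ, χ b ≠ 0 → ∃ ψ : A →ₐ[ℂ] ℂ, ψ.comp φ = χ := by
  have hft : φ.toRingHom.FiniteType := by
    have : (φ.toRingHom.comp (algebraMap ℂ B)).FiniteType := by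
      have h : φ.toRingHom.comp (algebraMap ℂ B) = algebraMap ℂ A := by
        ext x; simp
      rw [h]
      exact RingHom.finiteType_algebraMap.mpr inferInstance
    exact this.of_comp_finiteType
  have hfp : φ.toRingHom.FinitePresentation := by
    algebraize [φ.toRingHom]
    exact RingHom.FinitePresentation.of_finiteType.mp hft
  have hc := PrimeSpectrum.isConstructible_range_comap hfp
  rw [← PrimeSpectrum.exists_constructibleSetData_iff] at hc
  obtain ⟨D, hD⟩ := hc
  have hbot : (⊥ : PrimeSpectrum B) ∈ Set.range (PrimeSpectrum.comap φ.toRingHom) := by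
    refine ⟨⊥, ?_⟩
    ext x
    simp only [PrimeSpectrum.comap_asIdeal]
    rw [Ideal.mem_comap]
    change φ x ∈ (⊥ : Ideal A) ↔ x ∈ (⊥ : Ideal B)
    simp [map_eq_zero_iff φ hφ]
  rw [← hD] at hbot
  simp only [PrimeSpectrum.ConstructibleSetData.toSet, Set.mem_iUnion] at hbot
  obtain ⟨C, hC, h1⟩ := hbot
  rw [PrimeSpectrum.BasicConstructibleSetData.toSet] at h1
  obtain ⟨h2, h3⟩ := h1
  have hf0 : C.f ≠ 0 := by
    intro h0
    apply h3
    rw [PrimeSpectrum.mem_zeroLocus, h0]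
    simp
  have hg0 : ∀ i, C.g i = 0 := by
    intro i
    rw [PrimeSpectrum.mem_zeroLocus] at h2
    have := h2 ⟨i, rfl⟩
    change C.g i ∈ (⊥ : Ideal B) at this
    simpa using this
  refine ⟨C.f, hf0, fun χ hχ => ?_⟩
  have hprime : (RingHom.ker χ).IsPrime := RingHom.ker_isPrime _
  have hmem : (⟨RingHom.ker χ, hprime⟩ : PrimeSpectrum B) ∈
      Set.range (PrimeSpectrum.comap φ.toRingHom) := by
    rw [← hD]
    simp only [PrimeSpectrum.ConstructibleSetData.toSet, Set.mem_iUnion]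
    refine ⟨C, hC, ?_⟩
    rw [PrimeSpectrum.BasicConstructibleSetData.toSet]
    refine ⟨?_, ?_⟩
    · rw [PrimeSpectrum.mem_zeroLocus]
      rintro _ ⟨i, rfl⟩
      simp [hg0 i]
    · intro h
      rw [PrimeSpectrum.mem_zeroLocus] at h
      exact hχ (h rfl)
  obtain ⟨q, hq⟩ := hmem
  have : Nontrivial (A ⧸ q.asIdeal) := Ideal.Quotient.nontrivial_iff.mpr q.2.ne_top
  obtain ⟨ψ⟩ := nullst (k := ℂ) (R := A ⧸ q.asIdeal)
  refine ⟨ψ.comp (Ideal.Quotient.mkₐ ℂ q.asIdeal), ?_⟩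
  ext b
  have hb : b - algebraMap ℂ B (χ b) ∈ RingHom.ker χ := by
    simp [RingHom.mem_ker]
  have hq' : q.asIdeal.comap φ.toRingHom = RingHom.ker χ := by
    have := congrArg PrimeSpectrum.asIdeal hq
    simpa using this
  rw [← hq', Ideal.mem_comap] at hb
  have h4 : Ideal.Quotient.mkₐ ℂ q.asIdeal (φ (b - algebraMap ℂ B (χ b))) = 0 := by
    simpa using Ideal.Quotient.eq_zero_iff_mem.mpr hb
  have h5 := congrArg ψ h4
  rw [map_sub, map_sub, map_sub, map_zero, AlgHom.commutes, AlgHom.commutes, AlgHom.commutes,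
    sub_eq_zero] at h5
  exact h5

open Polynomial in
theorem exists_deriv {k K : Type*} [Field k] [CharZero k] [Field K] [Algebra k K] (t : K)
    (ht : Transcendental k t) [FiniteDimensional (IntermediateField.adjoin k {t}) K] :
    ∃ D : Derivation k K K, D t = 1 := by
  let : Algebra k[X] K := (Polynomial.aeval t).toAlgebra
  have htow : IsScalarTower k k[X] K := IsScalarTower.of_algHom (Polynomial.aeval t)
  let F := IntermediateField.adjoin k {t}
  have hF : CharZero F := charZero_of_injective_algebraMap (algebraMap k F).injective
  let : Algebra k[X] F := (Polynomial.aeval (⟨t, IntermediateField.mem_adjoin_simple_self k t⟩ : F)).toAlgebra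
  have hcoe : ∀ p : k[X], ((algebraMap k[X] F p : F) : K) = Polynomial.aeval t p := by
    intro p
    change algebraMap F K (Polynomial.aeval _ p) = _
    rw [← Polynomial.aeval_algebraMap_apply]
    rfl
  have hinj := transcendental_iff_injective.mp ht
  have hloc : IsFractionRing k[X] F := by
    have : FaithfulSMul k[X] F := by
      rw [faithfulSMul_iff_algebraMap_injective]
      intro p q hpq
      apply hinj
      rw [← hcoe, ← hcoe, hpq]
    refine IsFractionRing.of_field _ _ fun z => ?_
    obtain ⟨r, s, h⟩ := (IntermediateField.mem_adjoin_simple_iff k (z : K)).mp z.2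
    refine ⟨r, s, Subtype.ext ?_⟩
    rw [h, ← hcoe, ← hcoe]
    rfl
  have htow2 : IsScalarTower k[X] F K := by
    refine IsScalarTower.of_algebraMap_eq fun p => ?_
    change Polynomial.aeval t p = algebraMap F K (Polynomial.aeval _ p)
    rw [← Polynomial.aeval_algebraMap_apply]
    rfl
  have h1 : Algebra.FormallyEtale k[X] F := Algebra.FormallyEtale.of_isLocalization (nonZeroDivisors k[X])
  have h2 : Algebra.FormallyEtale F K := Algebra.FormallyEtale.of_isSeparable F K
  have h3 : Algebra.FormallyEtale k[X] K := Algebra.FormallyEtale.comp k[X] F K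
  let e1 := (KaehlerDifferential.tensorKaehlerEquivOfFormallyEtale k k[X] K).symm
  let l2 : TensorProduct k[X] K (Ω[k[X]⁄k]) →ₗ[K] K :=
    (TensorProduct.AlgebraTensorModule.rid k[X] K K).toLinearMap ∘ₗ
    (TensorProduct.AlgebraTensorModule.map (LinearMap.id : K →ₗ[K] K) (KaehlerDifferential.polynomialEquiv k).toLinearMap)
  refine ⟨(l2 ∘ₗ e1.toLinearMap).compDer (KaehlerDifferential.D k K), ?_⟩
  have h4 : algebraMap k[X] K Polynomial.X = t := by
    change Polynomial.aeval t Polynomial.X = t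
    simp
  have h5 := KaehlerDifferential.tensorKaehlerEquivOfFormallyEtale_symm_D_algebraMap k k[X] K Polynomial.X
  rw [h4] at h5
  change l2 (e1 _) = 1
  change e1 _ = _ at h5
  exact (congrArg l2 h5).trans (by simp [l2])

theorem deriv_ker {k K : Type*} [Field k] [CharZero k] [Field K] [Algebra k K] (t : K)
    (D : Derivation k K K) (hD : D t = 1) (u : K)
    (h : IsAlgebraic (IntermediateField.adjoin k {u}) t) : D u ≠ 0 := by
  intro hu
  have hz : ∀ x ∈ IntermediateField.adjoin k {u}, D x = 0 := by
    intro x hx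
    induction hx using IntermediateField.adjoin_induction with
    | mem x hx => rw [Set.mem_singleton_iff.mp hx]; exact hu
    | algebraMap x => simp
    | add x y _ _ hx hy => simp [hx, hy]
    | inv x _ hx => simp [Derivation.leibniz_inv, hx]
    | mul x y _ _ hx hy => simp [hx, hy]
  let F := IntermediateField.adjoin k {u}
  have hF : CharZero F := charZero_of_injective_algebraMap (algebraMap k F).injective
  let D' : Derivation F K K := 
    { toFun := D
      map_add' := by simp
      map_smul' := by
        intro c x
        rw [Algebra.smul_def, Derivation.leibniz]
        have : D (c : K) = 0 := hz _ c.2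
        simp [this, Algebra.smul_def]
      map_one_eq_zero' := by simp
      leibniz' := by intro a b; simp }
  have hint : IsIntegral F t := h.isIntegral
  have h1 := Derivation.map_aeval D' (minpoly F t) t
  rw [minpoly.aeval, map_zero] at h1
  have h2 : D' t = 1 := hD
  rw [h2, smul_eq_mul, mul_one] at h1
  have hs : (minpoly F t).Separable := (minpoly.irreducible hint).separable
  exact hs.aeval_derivative_ne_zero (minpoly.aeval F t) h1.symm

theorem mem_valsub_of_integral {k K : Type*} [Field k] [Field K] [Algebra k K] (V : ValuationSubring K)
    (A : Subalgebra k K) (hA : ∀ x ∈ A, x ∈ V) (γ : K) (h : IsIntegral A γ) : γ ∈ V := by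
  let i : A →+* V := { toFun := fun x => ⟨x.1, hA _ x.2⟩, map_one' := rfl, map_mul' := fun _ _ => rfl, map_zero' := rfl, map_add' := fun _ _ => rfl }
  let := i.toAlgebra
  have : IsScalarTower A V K := IsScalarTower.of_algebraMap_eq fun _ => rfl
  have h2 : IsIntegral V γ := h.tower_top
  obtain ⟨y, hy⟩ := IsIntegrallyClosed.isIntegral_iff.mp h2
  rw [← hy]; exact y.2

theorem const_of_integral {k K : Type*} [Field k] [IsAlgClosed k] [Field K] [Algebra k K] (t γ : K)
    (h1 : IsIntegral (Algebra.adjoin k {t}) γ) (h2 : IsIntegral (Algebra.adjoin k {t⁻¹}) γ) :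
    γ ∈ Set.range (algebraMap k K) := by
  have key : γ ∈ (integralClosure (Subring.closure (Set.range (algebraMap k K))) K).toSubring := by
    rw [← iInf_valuationSubring_superset, Subring.mem_iInf]
    rintro ⟨V, hV⟩
    have hk : ∀ c, algebraMap k K c ∈ V := fun c => hV ⟨c, rfl⟩
    have aux : ∀ s ∈ V, ∀ x ∈ Algebra.adjoin k {s}, x ∈ V := by
      intro s hs x hx
      induction hx using Algebra.adjoin_induction with
      | mem x hx => rw [Set.mem_singleton_iff.mp hx]; exact hs
      | algebraMap r => exact hk r
      | add x y _ _ hx hy => exact add_mem hx hy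
      | mul x y _ _ hx hy => exact mul_mem hx hy
    rcases V.mem_or_inv_mem t with h | h
    · exact mem_valsub_of_integral V _ (aux _ h) γ h1
    · exact mem_valsub_of_integral V _ (aux _ h) γ h2
  have h3 : IsIntegral (Subring.closure (Set.range (algebraMap k K))) γ := key
  have h4 : Subring.closure (Set.range (algebraMap k K)) = (algebraMap k K).range := by
    rw [← RingHom.coe_range, Subring.closure_eq]
  have h5 : IsIntegral k γ := by
    obtain ⟨p, hp, hpe⟩ := h3
    have hl : p ∈ Polynomial.lifts ((algebraMap k K).codRestrict (Subring.closure (Set.range (algebraMap k K)))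
        (fun x => Subring.subset_closure ⟨x, rfl⟩)) := by
      rw [Polynomial.lifts_iff_coeff_lifts]
      intro n
      obtain ⟨c, hc⟩ := h4.le (p.coeff n).2
      exact ⟨c, Subtype.ext hc⟩
    obtain ⟨q, hq, _, hqm⟩ := Polynomial.lifts_and_natDegree_eq_and_monic hl hp
    refine ⟨q, hqm, ?_⟩
    rw [← hq, Polynomial.eval₂_map] at hpe
    exact hpe
  have h6 := (IsAlgClosed.splits (minpoly k γ)).degree_eq_one_of_irreducible (minpoly.irreducible h5)
  exact minpoly.mem_range_of_degree_eq_one k γ h6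

open IsDedekindDomain in
open Polynomial in
theorem unit_val {k K : Type*} [Field k] [CharZero k] [IsAlgClosed k] [Field K] [Algebra k K] (t : K)
    (ht : Transcendental k t) [FiniteDimensional (IntermediateField.adjoin k {t}) K] :
    ∃ (n : ℕ) (v : Fin n → Valuation K (WithZero (Multiplicative ℤ))), (∀ i c, v i (algebraMap k K c) ≤ 1) ∧
      ∀ γ, IsIntegral (Algebra.adjoin k {t⁻¹}) γ → (∀ i, v i γ ≤ 1) → γ ∈ Set.range (algebraMap k K) := by
  let : Algebra k[X] K := (Polynomial.aeval t).toAlgebra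
  have htow : IsScalarTower k k[X] K := IsScalarTower.of_algHom (Polynomial.aeval t)
  let F := IntermediateField.adjoin k {t}
  have hF : CharZero F := charZero_of_injective_algebraMap (algebraMap k F).injective
  let : Algebra k[X] F := (Polynomial.aeval (⟨t, IntermediateField.mem_adjoin_simple_self k t⟩ : F)).toAlgebra
  have hcoe : ∀ p : k[X], ((algebraMap k[X] F p : F) : K) = Polynomial.aeval t p := by
    intro p
    change algebraMap F K (Polynomial.aeval _ p) = _
    rw [← Polynomial.aeval_algebraMap_apply]
    rfl
  have hinj := transcendental_iff_injective.mp ht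
  have hloc : IsFractionRing k[X] F := by
    have : FaithfulSMul k[X] F := by
      rw [faithfulSMul_iff_algebraMap_injective]
      intro p q hpq
      apply hinj
      rw [← hcoe, ← hcoe, hpq]
    refine IsFractionRing.of_field _ _ fun z => ?_
    obtain ⟨r, s, h⟩ := (IntermediateField.mem_adjoin_simple_iff k (z : K)).mp z.2
    refine ⟨r, s, Subtype.ext ?_⟩
    rw [h, ← hcoe, ← hcoe]
    rfl
  have htow2 : IsScalarTower k[X] F K := by
    refine IsScalarTower.of_algebraMap_eq fun p => ?_
    exact (hcoe p).symm
  let B := integralClosure k[X] K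
  have hB : IsDedekindDomain B := integralClosure.isDedekindDomain k[X] F K
  have hBK : IsFractionRing B K := integralClosure.isFractionRing_of_finite_extension F K
  let tB : B := algebraMap k[X] B X
  have htB : algebraMap B K tB = t := by
    change Polynomial.aeval t X = t
    simp
  have ht0 : t ≠ 0 := by rintro rfl; exact ht isAlgebraic_zero
  have htB0 : tB ≠ 0 := by
    intro h; rw [h, map_zero] at htB; exact ht0 htB.symm
  have hfin := Ideal.finite_factors (I := Ideal.span {tB}) (by simpa using htB0)
  let := hfin.fintype
  let e := (Fintype.equivFin {v : HeightOneSpectrum B | v.asIdeal ∣ Ideal.span {tB}}).symm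
  refine ⟨_, fun i => (e i).1.valuation K, ?_, ?_⟩
  · intro i c
    have : algebraMap k K c = algebraMap B K (algebraMap k[X] B (C c)) := by
      change _ = Polynomial.aeval t (C c)
      simp
    rw [this]
    exact HeightOneSpectrum.valuation_le_one _ _
  · intro γ hγ hv
    have h1 : ∀ v : HeightOneSpectrum B, v.valuation K γ ≤ 1 := by
      intro v
      by_cases hd : v.asIdeal ∣ Ideal.span {tB}
      · have := hv (e.symm ⟨v, hd⟩)
        simpa using this
      · have h2 : v.valuation K t = 1 := by
          rw [← htB, HeightOneSpectrum.valuation_eq_one_iff_notMem]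
          intro hm
          apply hd
          rw [Ideal.dvd_iff_le]
          simpa using hm
        have : γ ∈ (v.valuation K).valuationSubring := by
          refine mem_valsub_of_integral _ (Algebra.adjoin k {t⁻¹}) ?_ γ hγ
          intro x hx
          induction hx using Algebra.adjoin_induction with
          | mem x hx => 
            rw [Set.mem_singleton_iff.mp hx]
            rw [Valuation.mem_valuationSubring_iff, map_inv₀, h2, inv_one]
          | algebraMap c => 
            rw [Valuation.mem_valuationSubring_iff]
            have : algebraMap k K c = algebraMap B K (algebraMap k[X] B (C c)) := by
              change _ = Polynomial.aeval t (C c)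
              simp
            rw [this]
            exact HeightOneSpectrum.valuation_le_one _ _
          | add x y _ _ hx hy => exact add_mem hx hy
          | mul x y _ _ hx hy => exact mul_mem hx hy
        exact this
    obtain ⟨b, hb⟩ := HeightOneSpectrum.mem_integers_of_valuation_le_one K γ h1
    refine const_of_integral t γ ?_ hγ
    have h3 : IsIntegral k[X] γ := by rw [← hb]; exact b.2
    obtain ⟨p, hp, hpe⟩ := h3
    have hmap : ∀ q : k[X], aeval t q ∈ Algebra.adjoin k {t} := fun q => by
      rw [Algebra.adjoin_singleton_eq_range_aeval]; exact ⟨q, rfl⟩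
    let i : k[X] →+* Algebra.adjoin k {t} := ((aeval t : k[X] →ₐ[k] K).toRingHom).codRestrict (Algebra.adjoin k {t}).toSubring hmap
    refine ⟨p.map i, hp.map i, ?_⟩
    rw [Polynomial.eval₂_map]
    exact hpe

theorem val_fin {k K Γ₀ : Type*} [Field k] [Field K] [Algebra k K] [LinearOrderedCommGroupWithZero Γ₀]
    (v : Valuation K Γ₀) (hv : ∀ c, v (algebraMap k K c) ≤ 1) (W : Submodule k K) [FiniteDimensional k W] :
    (v '' W).Finite := by
  let U : Γ₀ → Submodule k W := fun a =>
    { carrier := {x | v x ≤ a}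
      add_mem' := by
        intro x y hx hy
        exact (v.map_add _ _).trans (max_le hx hy)
      zero_mem' := by simp
      smul_mem' := by
        intro c x hx
        simp only [Set.mem_ofPred_eq, Submodule.coe_smul, Algebra.smul_def, map_mul]
        calc _ ≤ 1 * a := mul_le_mul' (hv c) hx
          _ = a := one_mul a }
  refine Set.Finite.of_finite_image (f := fun a => Module.finrank k (U a)) ?_ ?_
  · refine (Set.finite_Iic (Module.finrank k W)).subset ?_
    rintro _ ⟨a, _, rfl⟩
    exact Submodule.finrank_le _
  · have key : ∀ a b, b ∈ v '' W → a < b → Module.finrank k (U a) < Module.finrank k (U b) := by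
      rintro a _ ⟨x, hx, rfl⟩ h
      apply Submodule.finrank_lt_finrank_of_lt
      refine lt_of_le_of_ne (fun y hy => le_trans hy h.le) ?_
      intro he
      have : (⟨x, hx⟩ : W) ∈ U (v x) := le_refl (v x)
      rw [← he] at this
      exact absurd this (not_le.mpr h)
    intro a ha b hb hab
    rcases lt_trichotomy a b with h | h | h
    · exact absurd hab (key a b hb h).ne
    · exact h
    · exact absurd hab (key b a ha h).ne'

theorem dlog_fin {k K : Type*} [Field k] [Field K] [Algebra k K] (D : Derivation k K K)
    (Γ : Subgroup Kˣ) {n : ℕ} (ν : Additive Γ →+ (Fin n → ℤ))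
    (hν : ∀ γ : Γ, ν (Additive.ofMul γ) = 0 → D (γ : Kˣ) = 0) :
    ∃ W : Submodule k K, FiniteDimensional k W ∧ ∀ γ ∈ Γ, D (γ : K) / γ ∈ W := by
  let dl : Additive Γ →+ K :=
    { toFun := fun γ => D ((γ.toMul : Kˣ) : K) / ((γ.toMul : Kˣ) : K)
      map_zero' := by simp
      map_add' := by
        intro x y
        simp only [toMul_add, Subgroup.coe_mul, Units.val_mul, Derivation.leibniz, smul_eq_mul]
        field_simp
        ring }
  let νl := ν.toIntLinearMap
  have hfg : (LinearMap.range νl).FG := IsNoetherian.noetherian _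
  obtain ⟨T, hT⟩ := hfg
  have hTr : ∀ x ∈ T, ∃ y, νl y = x := by
    intro x hx
    have : x ∈ LinearMap.range νl := by rw [← hT]; exact Submodule.subset_span hx
    exact this
  choose! lift hlift using hTr
  refine ⟨Submodule.span k (dl '' (lift '' T)), ?_, ?_⟩
  · exact FiniteDimensional.span_of_finite k ((T.finite_toSet.image _).image _)
  · intro γ hγ
    let γ' : Additive Γ := Additive.ofMul ⟨γ, hγ⟩
    have h1 : νl γ' ∈ Submodule.span ℤ (νl '' (lift '' T)) := by
      have : νl '' (lift '' T) = T := by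
        rw [Set.image_image]
        conv_rhs => rw [← Set.image_id (T : Set (Fin n → ℤ))]
        exact Set.image_congr hlift
      rw [this, hT]
      exact ⟨_, rfl⟩
    rw [← Submodule.map_span] at h1
    obtain ⟨τ, hτ, hτe⟩ := h1
    have h2 : dl γ' = dl τ := by
      have h3 : νl (γ' - τ) = 0 := by rw [map_sub, hτe, sub_self]
      have h4 := hν (γ' - τ).toMul h3
      have h5 : dl (γ' - τ) = 0 := by
        change D _ / _ = 0
        rw [h4, zero_div]
      rw [map_sub] at h5
      exact sub_eq_zero.mp h5
    change dl γ' ∈ _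
    rw [h2]
    have h6 : dl.toIntLinearMap τ ∈ (Submodule.span ℤ (lift '' T)).map dl.toIntLinearMap := ⟨τ, hτ, rfl⟩
    rw [Submodule.map_span] at h6
    exact Submodule.span_le_restrictScalars ℤ k _ h6

theorem unit_core {k K : Type*} [Field k] [CharZero k] [IsAlgClosed k] [Field K] [Algebra k K] (t : K)
    (ht : Transcendental k t) [FiniteDimensional (IntermediateField.adjoin k {t}) K]
    (halg : ∀ u : K, u ∉ Set.range (algebraMap k K) → IsAlgebraic (IntermediateField.adjoin k {u}) t) :
    {u : K | u ∉ Set.range (algebraMap k K) ∧ IsIntegral (Algebra.adjoin k {t⁻¹}) u ∧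
      IsIntegral (Algebra.adjoin k {t⁻¹}) u⁻¹ ∧ IsIntegral (Algebra.adjoin k {t⁻¹}) (1 - u) ∧
      IsIntegral (Algebra.adjoin k {t⁻¹}) (1 - u)⁻¹}.Finite := by
  obtain ⟨D, hD⟩ := exists_deriv t ht
  have hker : ∀ u : K, u ∉ Set.range (algebraMap k K) → D u ≠ 0 := fun u hu => deriv_ker t D hD u (halg u hu)
  obtain ⟨n, v, hvk, hv⟩ := unit_val t ht
  let Γ : Subgroup Kˣ :=
    { carrier := {γ | IsIntegral (Algebra.adjoin k {t⁻¹}) (γ : K) ∧ IsIntegral (Algebra.adjoin k {t⁻¹}) ((γ⁻¹ : Kˣ) : K)}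
      mul_mem' := by
        rintro a b ⟨h1, h2⟩ ⟨h3, h4⟩
        refine ⟨h1.mul h3, ?_⟩
        rw [mul_inv]
        exact h2.mul h4
      one_mem' := by
        refine ⟨isIntegral_one, ?_⟩
        rw [inv_one]; exact isIntegral_one
      inv_mem' := by
        rintro a ⟨h1, h2⟩
        exact ⟨h2, by rw [inv_inv]; exact h1⟩ }
  let νm : Γ →* (Fin n → Multiplicative ℤ) := MonoidHom.pi fun i =>
    (WithZero.unitsWithZeroEquiv.toMonoidHom.comp (Units.map (v i).toMonoidWithZeroHom.toMonoidHom)).comp Γ.subtype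
  let ν : Additive Γ →+ (Fin n → ℤ) :=
    { toFun := fun γ i => (νm γ.toMul i).toAdd
      map_zero' := by ext i; simp
      map_add' := by intro x y; ext i; simp }
  have hν : ∀ γ : Γ, ν (Additive.ofMul γ) = 0 → D (γ : Kˣ) = 0 := by
    intro γ h
    by_contra hne
    refine hne ?_
    have h1 : ∀ i, v i ((γ : Kˣ) : K) = 1 := by
      intro i
      have h2 := congrFun h i
      have h3 : νm γ i = 1 := h2
      have h4 : Units.map (v i).toMonoidWithZeroHom.toMonoidHom (γ : Kˣ) = 1 :=
        (MulEquiv.map_eq_one_iff WithZero.unitsWithZeroEquiv).mp h3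
      have h5 := congrArg Units.val h4
      exact h5
    obtain ⟨c, hc⟩ := hv _ γ.2.1 (fun i => (h1 i).le)
    rw [← hc]
    simp
  obtain ⟨W, hW, hWγ⟩ := dlog_fin D Γ ν hν
  have hfinv : ∀ i, (v i '' W).Finite := fun i => val_fin (v i) (hvk i) W
  -- quotients
  have hkey : ∀ u : K, u ∉ Set.range (algebraMap k K) → IsIntegral (Algebra.adjoin k {t⁻¹}) u →
      IsIntegral (Algebra.adjoin k {t⁻¹}) u⁻¹ → IsIntegral (Algebra.adjoin k {t⁻¹}) (1 - u) →
      IsIntegral (Algebra.adjoin k {t⁻¹}) (1 - u)⁻¹ → ∀ i, v i u ∈ Set.image2 (· / ·) (v i '' W) (v i '' W) := by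
    intro u hu h1 h2 h3 h4 i
    have hu0 : u ≠ 0 := by rintro rfl; exact hu ⟨0, map_zero _⟩
    have hu1 : 1 - u ≠ 0 := by
      intro h; exact hu ⟨1, by rw [map_one]; exact sub_eq_zero.mp h⟩
    have e1 := hWγ (Units.mk0 u hu0) ⟨h1, by simpa using h2⟩
    have e2 := hWγ (Units.mk0 (1 - u) hu1) ⟨h3, by simpa using h4⟩
    simp only [Units.val_mk0] at e1 e2
    have hDu := hker u hu
    have e3 : D (1 - u) = - D u := by simp
    refine ⟨_, ⟨_, W.neg_mem e2, rfl⟩, _, ⟨_, W.sub_mem e1 e2, rfl⟩, ?_⟩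
    simp only
    rw [← map_div₀]
    congr 1
    rw [e3]
    field_simp
    ring
  refine Set.Finite.of_finite_image (f := fun u => ((fun i => v i u), (fun i => v i (1 - u)))) ?_ ?_
  · refine (Set.Finite.prod (Set.Finite.pi' fun i => (hfinv i).image2 (· / ·) (hfinv i))
      (Set.Finite.pi' fun i => (hfinv i).image2 (· / ·) (hfinv i))).subset ?_
    rintro _ ⟨u, ⟨h0, h1, h2, h3, h4⟩, rfl⟩
    refine ⟨fun i => hkey u h0 h1 h2 h3 h4 i, fun i => hkey (1 - u) ?_ h3 h4 ?_ ?_ i⟩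
    · rintro ⟨c, hc⟩
      exact h0 ⟨1 - c, by rw [map_sub, hc]; simp⟩
    · simpa using h1
    · simpa using h2
  · have hratio : ∀ a b : K, a ≠ 0 → IsIntegral (Algebra.adjoin k {t⁻¹}) b → 
      IsIntegral (Algebra.adjoin k {t⁻¹}) a⁻¹ → (∀ i, v i a = v i b) → ∃ c, b = algebraMap k K c * a := by
      intro a b ha h1 h2 h3
      obtain ⟨c, hc⟩ := hv (b * a⁻¹) (h1.mul h2) (fun i => by
        rw [map_mul, map_inv₀, ← h3]
        exact mul_inv_le_one)
      exact ⟨c, by rw [hc]; field_simp⟩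
    rintro u ⟨h0, h1, h2, h3, h4⟩ w ⟨h0', h1', h2', h3', h4'⟩ he
    simp only [Prod.mk.injEq] at he
    have hu0 : u ≠ 0 := by rintro rfl; exact h0 ⟨0, map_zero _⟩
    have hu1 : 1 - u ≠ 0 := by
      intro h; exact h0 ⟨1, by rw [map_one]; exact sub_eq_zero.mp h⟩
    obtain ⟨c, hc⟩ := hratio u w hu0 h1' h2 (fun i => congrFun he.1 i)
    obtain ⟨e, hee⟩ := hratio (1 - u) (1 - w) hu1 h3' h4 (fun i => congrFun he.2 i)
    have h5 : algebraMap k K (c - e) * u = algebraMap k K (1 - e) := by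
      simp only [map_sub, map_one]
      linear_combination -hee - hc
    by_cases hce : c - e = 0
    · rw [hce, map_zero, zero_mul] at h5
      have : 1 - e = 0 := by
        apply (algebraMap k K).injective; rw [← h5, map_zero]
      have hc1 : c = 1 := by linear_combination hce - this
      rw [hc, hc1]; simp
    · exfalso
      apply h0
      refine ⟨(1 - e) / (c - e), ?_⟩
      rw [map_div₀, ← h5]
      have : algebraMap k K (c - e) ≠ 0 := (map_ne_zero _).mpr hce
      field_simp

theorem const_of_alg {k K : Type*} [Field k] [IsAlgClosed k] [Field K] [Algebra k K] (γ : K)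
    (h : IsAlgebraic k γ) : γ ∈ Set.range (algebraMap k K) := by
  have h6 := (IsAlgClosed.splits (minpoly k γ)).degree_eq_one_of_irreducible (minpoly.irreducible h.isIntegral)
  exact minpoly.mem_range_of_degree_eq_one k γ h6

theorem alg_of_h2 {k L : Type*} [Field k] [IsAlgClosed k] [Field L] [Algebra k L]
    (h2 : ∀ x : Option (Fin 1) → L, ¬ AlgebraicIndependent k x) (u t : L)
    (hu : u ∉ Set.range (algebraMap k L)) : IsAlgebraic (IntermediateField.adjoin k {u}) t := by
  have htr : Transcendental k u := fun h => hu (const_of_alg u h)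
  have h1 : AlgebraicIndependent k (fun _ : Fin 1 => u) := by
    rw [algebraicIndependent_unique_type_iff]; exact htr
  have h3 := h2 (fun o => o.elim t (fun _ => u))
  rw [h1.option_iff_transcendental] at h3
  have h4 : IsAlgebraic (Algebra.adjoin k (Set.range (fun _ : Fin 1 => u))) t := not_not.mp h3
  have h5 : Set.range (fun _ : Fin 1 => u) = {u} := Set.range_const
  rw [h5] at h4
  obtain ⟨p, hp, hpe⟩ := h4
  let i : Algebra.adjoin k {u} →+* IntermediateField.adjoin k {u} :=
    (Algebra.adjoin k {u}).toSubring.subtype.codRestrict (IntermediateField.adjoin k {u}).toSubring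
      (fun x => IntermediateField.algebra_adjoin_le_adjoin k {u} x.2)
  have hi : Function.Injective i := fun x y h => Subtype.ext (congrArg (fun z : IntermediateField.adjoin k {u} => (z : L)) h)
  refine ⟨p.map i, (Polynomial.map_ne_zero_iff hi).mpr hp, ?_⟩
  rw [Polynomial.aeval_def, Polynomial.eval₂_map]
  exact hpe

theorem unit_aux {k R K : Type*} [Field k] [CharZero k] [IsAlgClosed k] [CommRing R] [IsDomain R] [Algebra k R]
    [Field K] [Algebra k K] [Algebra R K] [IsScalarTower k R K] [IsFractionRing R K]
    (h2K : ∀ x : Option (Fin 1) → K, ¬ AlgebraicIndependent k x) (hft : Algebra.FiniteType k R) :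
    {u : R | algebraMap R K u ∉ Set.range (algebraMap k K) ∧ IsUnit u ∧ IsUnit (1 - u)}.Finite := by
  obtain ⟨s, g, hg, hint⟩ := exists_integral_inj_algHom_of_fg k R
  let j : R →ₐ[k] K := IsScalarTower.toAlgHom k R K
  have hj : Function.Injective j := IsFractionRing.injective R K
  have hs : s ≤ 1 := by
    by_contra hs
    push Not at hs
    have h3 : AlgebraicIndependent k (fun i : Fin s => j (g (X i))) :=
      (MvPolynomial.algebraicIndependent_X (Fin s) k).map' (f := j.comp g)
        (hj.comp hg)
    refine h2K _ (h3.comp (fun o : Option (Fin 1) => o.elim (⟨0, by omega⟩ : Fin s) (fun _ => ⟨1, hs⟩)) ?_)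
    intro a b hab
    rcases a with _ | a <;> rcases b with _ | b <;> simp at hab ⊢
    exact Subsingleton.elim _ _
  rcases Nat.le_one_iff_eq_zero_or_eq_one.mp hs with rfl | rfl
  · convert Set.finite_empty
    rw [Set.eq_empty_iff_forall_notMem]
    rintro u ⟨h0, -⟩
    apply h0
    have h4 : IsIntegral k u := by
      obtain ⟨p, hp, hpe⟩ := hint u
      let e := MvPolynomial.isEmptyAlgEquiv k (Fin 0)
      refine ⟨p.map e.toRingHom, hp.map _, ?_⟩
      rw [Polynomial.eval₂_map]
      rw [← hpe]
      congr 1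
      refine RingHom.ext fun x => ?_
      obtain ⟨c, rfl⟩ := MvPolynomial.C_surjective (Fin 0) x
      have h1 : e (C c) = c := e.apply_symm_apply c
      have h3 : g (C c) = algebraMap k R c := g.commutes c
      exact (congrArg (algebraMap k R) h1).trans h3.symm
    exact const_of_alg _ (h4.isAlgebraic.algHom j)
  · let t : R := g (X 0)
    have htr : Transcendental k (j t) := by
      rw [← algebraicIndependent_unique_type_iff (ι := Fin 1) (x := fun _ => j t)]
      have := (MvPolynomial.algebraicIndependent_X (Fin 1) k).map' (f := j.comp g) (hj.comp hg)
      convert this using 1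
      ext i
      have : i = 0 := Subsingleton.elim _ _
      subst this
      rfl
    have hgm : ∀ p, j (g p) ∈ Algebra.adjoin k {j t} := by
      intro p
      induction p using MvPolynomial.induction_on with
      | C a => 
        have : C a = algebraMap k (MvPolynomial (Fin 1) k) a := rfl
        rw [this, AlgHom.commutes, AlgHom.commutes]
        exact Subalgebra.algebraMap_mem _ _
      | add p q hp hq => simpa using add_mem hp hq
      | mul_X p i hp =>
        have : i = 0 := Subsingleton.elim _ _
        subst this
        rw [map_mul, map_mul]
        exact mul_mem hp (Algebra.subset_adjoin rfl)
    have hintK : ∀ r : R, IsIntegral (Algebra.adjoin k {j t}) (j r) := by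
      intro r
      obtain ⟨p, hp, hpe⟩ := hint r
      let i : MvPolynomial (Fin 1) k →+* Algebra.adjoin k {j t} :=
        ((j.comp g).toRingHom).codRestrict (Algebra.adjoin k {j t}).toSubring hgm
      refine ⟨p.map i, hp.map i, ?_⟩
      rw [Polynomial.eval₂_map]
      have h5 := congrArg j hpe
      rw [map_zero] at h5
      rw [← h5]
      exact (Polynomial.hom_eval₂ p g.toRingHom j.toRingHom r).symm
    have hinvadj : IntermediateField.adjoin k {(j t)⁻¹} = IntermediateField.adjoin k {j t} := by
      apply le_antisymm
      · rw [IntermediateField.adjoin_simple_le_iff]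
        exact inv_mem (IntermediateField.mem_adjoin_simple_self k _)
      · rw [IntermediateField.adjoin_simple_le_iff]
        have := inv_mem (IntermediateField.mem_adjoin_simple_self k (j t)⁻¹)
        rwa [inv_inv] at this
    have hfd : FiniteDimensional (IntermediateField.adjoin k {(j t)⁻¹}) K := by
      rw [hinvadj]
      obtain ⟨T, hT⟩ := hft.out
      have h6 : FiniteDimensional (IntermediateField.adjoin k {j t})
        (IntermediateField.adjoin (IntermediateField.adjoin k {j t}) (j '' (T : Set R))) := by
        refine IntermediateField.finiteDimensional_adjoin (S := j '' T) ?_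
        rintro _ ⟨r, -, rfl⟩
        obtain ⟨p, hp, hpe⟩ := hintK r
        let i : Algebra.adjoin k {j t} →+* IntermediateField.adjoin k {j t} :=
          (Algebra.adjoin k {j t}).toSubring.subtype.codRestrict (IntermediateField.adjoin k {j t}).toSubring
          (fun x => IntermediateField.algebra_adjoin_le_adjoin k {j t} x.2)
        refine ⟨p.map i, hp.map i, ?_⟩
        rw [Polynomial.eval₂_map]
        exact hpe
      have h7 : IntermediateField.adjoin (IntermediateField.adjoin k {j t}) (j '' (T : Set R)) = ⊤ := by
        rw [eq_top_iff]
        have h8 : ∀ r : R, j r ∈ IntermediateField.adjoin (IntermediateField.adjoin k {j t}) (j '' (T : Set R)) := by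
          intro r
          have hr : r ∈ Algebra.adjoin k (T : Set R) := by rw [hT]; trivial
          induction hr using Algebra.adjoin_induction with
          | mem x hx => exact IntermediateField.subset_adjoin _ _ ⟨x, hx, rfl⟩
          | algebraMap c => 
            rw [AlgHom.commutes]
            exact IntermediateField.algebraMap_mem _ (algebraMap k (IntermediateField.adjoin k {j t}) c)
          | add x y _ _ hx hy => rw [map_add]; exact add_mem hx hy
          | mul x y _ _ hx hy => rw [map_mul]; exact mul_mem hx hy
        intro z _
        obtain ⟨x, y, -, rfl⟩ := IsFractionRing.div_surjective R z
        exact div_mem (h8 x) (h8 y)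
      rw [h7] at h6
      exact Module.Finite.equiv (IntermediateField.topEquiv (F := IntermediateField.adjoin k {j t}) (E := K)).toLinearEquiv
    have htr' : Transcendental k (j t)⁻¹ := by
      intro h; exact htr (by simpa using h.inv)
    have hfin := unit_core (j t)⁻¹ htr' (fun u hu => alg_of_h2 h2K u _ hu)
    rw [inv_inv] at hfin
    refine Set.Finite.of_finite_image (f := j) (hfin.subset ?_) hj.injOn
    have hinv : ∀ u : R, IsUnit u → ∃ r, (j u)⁻¹ = j r := by
      rintro _ ⟨u, rfl⟩
      refine ⟨(u⁻¹ : Rˣ), ?_⟩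
      rw [inv_eq_iff_eq_inv]
      have : j u * j (u⁻¹ : Rˣ) = 1 := by rw [← map_mul]; simp
      exact eq_inv_of_mul_eq_one_left this
    rintro _ ⟨u, ⟨h0, h1, h3⟩, rfl⟩
    refine ⟨?_, hintK u, ?_, ?_, ?_⟩
    · rintro ⟨c, hc⟩
      exact h0 ⟨c, hc⟩
    · obtain ⟨r, hr⟩ := hinv u h1
      rw [hr]; exact hintK r
    · have := hintK (1 - u)
      rwa [map_sub, map_one] at this
    · obtain ⟨r, hr⟩ := hinv _ h3
      rw [map_sub, map_one] at hr
      rw [hr]; exact hintK r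

theorem unit_thm {k L : Type*} [Field k] [CharZero k] [IsAlgClosed k] [Field L] [Algebra k L]
    (h2 : ∀ x : Option (Fin 1) → L, ¬ AlgebraicIndependent k x) (R : Subalgebra k L) (hR : R.FG) :
    {u : R | (u : L) ∉ Set.range (algebraMap k L) ∧ IsUnit u ∧ IsUnit (1 - u)}.Finite := by
  have hft : Algebra.FiniteType k R := R.fg_iff_finiteType.mp hR
  let ι : FractionRing R →ₐ[k] L := IsFractionRing.liftAlgHom (g := R.val) Subtype.val_injective
  have hι : Function.Injective ι := ι.toRingHom.injective
  have hιj : ∀ r : R, ι (algebraMap R (FractionRing R) r) = r := fun r =>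
    IsFractionRing.lift_algebraMap (g := R.val.toRingHom) Subtype.val_injective r
  refine (unit_aux (k := k) (R := R) (K := FractionRing R) (fun x hx => h2 _ (hx.map' hι)) hft).subset ?_
  rintro u ⟨h0, h1⟩
  refine ⟨?_, h1⟩
  rintro ⟨c, hc⟩
  apply h0
  refine ⟨c, ?_⟩
  rw [← hιj, ← hc, AlgHom.commutes]

def hev {R : Type*} [CommRing R] {d : ℕ} (a : Fin (d + 1) → R) (v : Fin 2 → R) : R :=
  ∑ j : Fin (d + 1), a j * v 0 ^ (j : ℕ) * v 1 ^ (d - (j : ℕ))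

def GG {R : Type*} [CommRing R] {d : ℕ} (a b : Fin (d + 1) → R) (v : Fin 2 → R) : Fin 2 → R :=
  ![hev a v, hev b v]

def wdg {R : Type*} [CommRing R] (v w : Fin 2 → R) : R := v 0 * w 1 - v 1 * w 0

def PreV {R : Type*} [CommRing R] {d : ℕ} (a b : Fin (d + 1) → R) (v : Fin 2 → R) : Prop :=
  ∃ n m : ℕ, m < n ∧ wdg ((GG a b)^[n] v) ((GG a b)^[m] v) = 0

def GoodV {R : Type*} [CommRing R] {d : ℕ} (a b : Fin (d + 1) → R) : Prop :=
  ∀ v : Fin 2 → R, v ≠ 0 → GG a b v ≠ 0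

section ring
variable {R R' : Type*} [CommRing R] [CommRing R'] {d : ℕ} (a b : Fin (d + 1) → R)

theorem hev_smul (c : R) (v : Fin 2 → R) : hev a (c • v) = c ^ d * hev a v := by
  unfold hev
  rw [Finset.mul_sum]
  refine Finset.sum_congr rfl fun j _ => ?_
  have hj : (j : ℕ) + (d - j) = d := by omega
  have h2 : c ^ d = c ^ (j : ℕ) * c ^ (d - (j : ℕ)) := by rw [← pow_add, hj]
  rw [h2]
  simp only [Pi.smul_apply, smul_eq_mul, mul_pow]
  ring

theorem GG_smul (c : R) (v : Fin 2 → R) : GG a b (c • v) = c ^ d • GG a b v := by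
  ext i
  fin_cases i
  · exact hev_smul a c v
  · exact hev_smul b c v

theorem GG_iter_smul (c : R) (v : Fin 2 → R) (n : ℕ) : (GG a b)^[n] (c • v) = c ^ (d ^ n) • (GG a b)^[n] v := by
  induction n with
  | zero => simp
  | succ n ih => rw [Function.iterate_succ_apply', ih, GG_smul, Function.iterate_succ_apply', ← pow_mul, pow_succ]

theorem hev_map (f : R →+* R') (v : Fin 2 → R) : hev (fun j => f (a j)) (fun i => f (v i)) = f (hev a v) := by
  simp [hev]

theorem GG_map (f : R →+* R') (v : Fin 2 → R) :
    GG (fun j => f (a j)) (fun j => f (b j)) (fun i => f (v i)) = fun i => f (GG a b v i) := by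
  ext i
  fin_cases i
  · exact hev_map a f v
  · exact hev_map b f v

theorem GG_iter_map (f : R →+* R') (v : Fin 2 → R) (n : ℕ) :
    (GG (fun j => f (a j)) (fun j => f (b j)))^[n] (fun i => f (v i)) = fun i => f ((GG a b)^[n] v i) := by
  induction n with
  | zero => simp
  | succ n ih => rw [Function.iterate_succ_apply', ih, GG_map, Function.iterate_succ_apply']

theorem wdg_map (f : R →+* R') (v w : Fin 2 → R) : wdg (fun i => f (v i)) (fun i => f (w i)) = f (wdg v w) := by
  simp [wdg]

theorem PreV_map (f : R →+* R') (v : Fin 2 → R) (h : PreV a b v) :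
    PreV (fun j => f (a j)) (fun j => f (b j)) (fun i => f (v i)) := by
  obtain ⟨n, m, h1, h2⟩ := h
  refine ⟨n, m, h1, ?_⟩
  rw [GG_iter_map, GG_iter_map, wdg_map, h2, map_zero]

theorem PreV_of_map (f : R →+* R') (hf : Function.Injective f) (v : Fin 2 → R) 
    (h : PreV (fun j => f (a j)) (fun j => f (b j)) (fun i => f (v i))) : PreV a b v := by
  obtain ⟨n, m, h1, h2⟩ := h
  refine ⟨n, m, h1, ?_⟩
  rw [GG_iter_map, GG_iter_map, wdg_map] at h2
  exact hf (h2.trans (map_zero f).symm)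

theorem wdg_smul_left (c : R) (v w : Fin 2 → R) : wdg (c • v) w = c * wdg v w := by
  simp [wdg]; ring
theorem wdg_smul_right (c : R) (v w : Fin 2 → R) : wdg v (c • w) = c * wdg v w := by
  simp [wdg]; ring
theorem wdg_add_right (u v w : Fin 2 → R) : wdg u (v + w) = wdg u v + wdg u w := by
  simp [wdg]; ring
theorem wdg_add_left (u v w : Fin 2 → R) : wdg (u + v) w = wdg u w + wdg v w := by
  simp [wdg]; ring
theorem wdg_self (u : Fin 2 → R) : wdg u u = 0 := by
  simp [wdg]; ring
theorem wdg_swap (u v : Fin 2 → R) : wdg u v = - wdg v u := by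
  simp [wdg]; ring

theorem PreV_of_GG (v : Fin 2 → R) (h : PreV a b (GG a b v)) : PreV a b v := by
  obtain ⟨n, m, h1, h2⟩ := h
  exact ⟨n + 1, m + 1, by omega, h2⟩

theorem PreV_of_iter (v : Fin 2 → R) (n : ℕ) (h : PreV a b ((GG a b)^[n] v)) : PreV a b v := by
  induction n with
  | zero => exact h
  | succ n ih =>
    rw [Function.iterate_succ_apply'] at h
    exact ih (PreV_of_GG a b _ h)

theorem PreV_smul (c : R) (v : Fin 2 → R) (h : PreV a b v) : PreV a b (c • v) := by
  obtain ⟨n, m, h1, h2⟩ := h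
  refine ⟨n, m, h1, ?_⟩
  rw [GG_iter_smul, GG_iter_smul, wdg_smul_left, wdg_smul_right, h2]
  simp

end ring

section field
variable {F : Type*} [Field F] {d : ℕ} (a b : Fin (d + 1) → F)

theorem wdg_eq_zero {v w : Fin 2 → F} (hv : v ≠ 0) (h : wdg v w = 0) : ∃ c : F, w = c • v := by
  have h' : v 0 * w 1 = v 1 * w 0 := sub_eq_zero.mp h
  by_cases h0 : v 0 = 0
  · have h1 : v 1 ≠ 0 := by
      intro h1; apply hv; ext i; fin_cases i <;> assumption
    refine ⟨w 1 / v 1, ?_⟩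
    have h2 : w 0 = 0 := by
      rw [h0, zero_mul] at h'
      exact (mul_eq_zero.mp h'.symm).resolve_left h1
    ext i; fin_cases i
    · simp [h0, h2]
    · simp [h1]
  · refine ⟨w 0 / v 0, ?_⟩
    ext i; fin_cases i
    · simp [h0]
    · simp; field_simp; linear_combination h'

theorem wdg_eq_zero' {v w : Fin 2 → F} (hv : v ≠ 0) (hw : w ≠ 0) (h : wdg v w = 0) : ∃ c : F, c ≠ 0 ∧ w = c • v := by
  obtain ⟨c, hc⟩ := wdg_eq_zero hv h
  refine ⟨c, ?_, hc⟩
  rintro rfl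
  simp at hc; exact hw hc

theorem GG_zero (hd : d ≠ 0) : GG a b 0 = 0 := by
  have := GG_smul a b 0 0
  rwa [zero_smul, zero_pow hd, zero_smul] at this

theorem GG_wdg (hd : d ≠ 0) {v w : Fin 2 → F} (h : wdg v w = 0) : wdg (GG a b v) (GG a b w) = 0 := by
  by_cases hv : v = 0
  · rw [hv, GG_zero a b hd]; simp [wdg]
  · obtain ⟨c, rfl⟩ := wdg_eq_zero hv h
    rw [GG_smul, wdg_smul_right, wdg_self, mul_zero]

theorem PreV_GG (hd : d ≠ 0) {v : Fin 2 → F} (h : PreV a b v) : PreV a b (GG a b v) := by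
  obtain ⟨n, m, h1, h2⟩ := h
  refine ⟨n, m, h1, ?_⟩
  rw [← Function.iterate_succ_apply, ← Function.iterate_succ_apply, Function.iterate_succ_apply', Function.iterate_succ_apply']
  exact GG_wdg a b hd h2

theorem PreV_wdg {v w : Fin 2 → F} (hv : v ≠ 0) (h : wdg v w = 0) (hp : PreV a b v) : PreV a b w := by
  obtain ⟨c, rfl⟩ := wdg_eq_zero hv h
  exact PreV_smul a b c v hp

theorem iter_ne_zero (hg : GoodV a b) {v : Fin 2 → F} (hv : v ≠ 0) (n : ℕ) : (GG a b)^[n] v ≠ 0 := by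
  induction n with
  | zero => exact hv
  | succ n ih => rw [Function.iterate_succ_apply']; exact hg _ ih

theorem wdg_trans {u v w : Fin 2 → F} (hv : v ≠ 0) (h1 : wdg u v = 0) (h2 : wdg v w = 0) : wdg u w = 0 := by
  obtain ⟨c, rfl⟩ := wdg_eq_zero hv h2
  rw [wdg_smul_right, h1, mul_zero]

theorem vec_one_ne {z : F} : (![z, 1] : Fin 2 → F) ≠ 0 := by
  intro h; simpa using congrFun h 1

end field

section form
variable {F : Type*} [CommRing F]

def IsForm (d : ℕ) (h : (Fin 2 → F) → F) : Prop := ∃ a : Fin (d + 1) → F, ∀ v, hev a v = h v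

theorem IsForm.add {d : ℕ} {h h' : (Fin 2 → F) → F} (H : IsForm d h) (H' : IsForm d h') :
    IsForm d (fun v => h v + h' v) := by
  obtain ⟨a, ha⟩ := H
  obtain ⟨b, hb⟩ := H'
  refine ⟨fun j => a j + b j, fun v => ?_⟩
  change _ = h v + h' v
  rw [← ha, ← hb]
  simp only [hev, ← Finset.sum_add_distrib]
  refine Finset.sum_congr rfl fun j _ => by ring

theorem IsForm.smul {d : ℕ} {h : (Fin 2 → F) → F} (c : F) (H : IsForm d h) :
    IsForm d (fun v => c * h v) := by
  obtain ⟨a, ha⟩ := H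
  refine ⟨fun j => c * a j, fun v => ?_⟩
  beta_reduce
  rw [← ha]
  simp only [hev, Finset.mul_sum]
  refine Finset.sum_congr rfl fun j _ => by ring

theorem IsForm.mul0 {d : ℕ} {h : (Fin 2 → F) → F} (H : IsForm d h) :
    IsForm (d + 1) (fun v => v 0 * h v) := by
  obtain ⟨a, ha⟩ := H
  refine ⟨Fin.cons 0 a, fun v => ?_⟩
  beta_reduce
  rw [← ha]
  simp only [hev, Finset.mul_sum]
  rw [Fin.sum_univ_succ]
  simp only [Fin.cons_zero, zero_mul, zero_add, Fin.cons_succ, Fin.val_succ, Nat.add_sub_add_right]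
  refine Finset.sum_congr rfl fun j _ => by ring

theorem IsForm.mul1 {d : ℕ} {h : (Fin 2 → F) → F} (H : IsForm d h) :
    IsForm (d + 1) (fun v => v 1 * h v) := by
  obtain ⟨a, ha⟩ := H
  refine ⟨Fin.snoc a 0, fun v => ?_⟩
  beta_reduce
  rw [← ha]
  simp only [hev, Finset.mul_sum]
  rw [Fin.sum_univ_castSucc]
  simp only [Fin.snoc_castSucc, Fin.snoc_last, zero_mul, add_zero, Fin.val_castSucc]
  refine Finset.sum_congr rfl fun j _ => ?_
  have : d + 1 - (j:ℕ) = (d - j) + 1 := by omega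
  rw [this]; ring

theorem IsForm.mulLin {d : ℕ} {h : (Fin 2 → F) → F} (α β : F) (H : IsForm d h) :
    IsForm (d + 1) (fun v => (v 0 * α + v 1 * β) * h v) := by
  obtain ⟨a, ha⟩ := (H.mul0.smul α).add (H.mul1.smul β)
  exact ⟨a, fun v => by rw [ha]; ring⟩

theorem IsForm.mulPow {d : ℕ} {h : (Fin 2 → F) → F} (α β : F) (H : IsForm d h) (n : ℕ) :
    IsForm (d + n) (fun v => (v 0 * α + v 1 * β) ^ n * h v) := by
  induction n with
  | zero => obtain ⟨a, ha⟩ := H; exact ⟨a, fun v => by rw [ha]; ring⟩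
  | succ n ih => 
    obtain ⟨a, ha⟩ := ih.mulLin α β
    exact ⟨a, fun v => by rw [ha]; ring⟩

theorem IsForm.one : IsForm 0 (fun _ : Fin 2 → F => 1) := ⟨fun _ => 1, fun v => by simp [hev]⟩

theorem IsForm.zero (d : ℕ) : IsForm d (fun _ : Fin 2 → F => 0) := ⟨fun _ => 0, fun v => by simp [hev]⟩

theorem IsForm.sum {d : ℕ} {ι : Type*} (s : Finset ι) (h : ι → (Fin 2 → F) → F) (H : ∀ i, IsForm d (h i)) :
    IsForm d (fun v => ∑ i ∈ s, h i v) := by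
  classical
  induction s using Finset.induction_on with
  | empty => simpa using IsForm.zero d
  | insert i s hi ih =>
    simp only [Finset.sum_insert hi]
    exact (H i).add ih

theorem IsForm.subst {d : ℕ} (a : Fin (d + 1) → F) (p q : Fin 2 → F) :
    IsForm d (fun v => hev a (v 0 • p + v 1 • q)) := by
  unfold hev
  refine IsForm.sum _ _ fun j => ?_
  have h1 := (((IsForm.one (F := F)).mulPow (p 0) (q 0) j).mulPow (p 1) (q 1) (d - j)).smul (a j)
  have : 0 + (j:ℕ) + (d - j) = d := by omega
  rw [this] at h1
  obtain ⟨c, hc⟩ := h1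
  refine ⟨c, fun v => ?_⟩
  rw [hc]
  simp
  ring

end form

def pol {R : Type*} [CommRing R] {d : ℕ} (a : Fin (d + 1) → R) : Polynomial R :=
  ∑ j : Fin (d + 1), Polynomial.C (a j) * Polynomial.X ^ (j : ℕ)

theorem pol_eval {R : Type*} [CommRing R] {d : ℕ} (a : Fin (d + 1) → R) (z : R) :
    (pol a).eval z = hev a ![z, 1] := by
  simp [pol, hev, Polynomial.eval_finsetSum]

theorem pol_coeff {R : Type*} [CommRing R] {d : ℕ} (a : Fin (d + 1) → R) :
    (pol a).coeff d = hev a ![1, 0] := by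
  simp only [pol, hev, Polynomial.finsetSum_coeff, Polynomial.coeff_C_mul, Polynomial.coeff_X_pow]
  refine Finset.sum_congr rfl fun j _ => ?_
  by_cases h : d = j
  · simp [← h]
  · have : d - (j:ℕ) ≠ 0 := by omega
    simp [h, this]

theorem pol_natDegree {R : Type*} [CommRing R] {d : ℕ} (a : Fin (d + 1) → R) :
    (pol a).natDegree ≤ d := by
  refine Polynomial.natDegree_sum_le_of_forall_le _ _ fun j _ => ?_
  exact (Polynomial.natDegree_C_mul_X_pow_le _ _).trans (by omega)

open Polynomial in
theorem three_pow {L : Type*} [Field L] [CharZero L] {d : ℕ} (hd : 2 ≤ d) (e1 e2 e3 l1 l2 l3 : L)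
    (h12 : e1 ≠ e2) (h13 : e1 ≠ e3) 
    (h : Polynomial.C l1 * (Polynomial.X - Polynomial.C e1) ^ d + Polynomial.C l2 * (Polynomial.X - Polynomial.C e2) ^ d + Polynomial.C l3 * (Polynomial.X - Polynomial.C e3) ^ d = 0) : l1 = 0 := by
  obtain ⟨m, rfl⟩ : ∃ m, d = m + 2 := ⟨d - 2, by omega⟩
  have c0 := congrArg (fun p => Polynomial.coeff p (m + 2)) h
  have c1 := congrArg (fun p => Polynomial.coeff p (m + 1)) h
  have c2 := congrArg (fun p => Polynomial.coeff p m) h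
  simp only [Polynomial.coeff_add, Polynomial.coeff_C_mul, sub_eq_add_neg, ← Polynomial.C_neg, Polynomial.coeff_X_add_C_pow, Polynomial.coeff_zero] at c0 c1 c2
  have s1 : m + 2 - (m + 1) = 1 := by omega
  have s2 : m + 2 - m = 2 := by omega
  have n1 : (((m + 2).choose (m + 1) : ℕ) : L) ≠ 0 := by
    exact_mod_cast (Nat.choose_pos (by omega)).ne'
  have n2 : (((m + 2).choose m : ℕ) : L) ≠ 0 := by
    exact_mod_cast (Nat.choose_pos (by omega)).ne'
  rw [s1] at c1
  rw [s2] at c2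
  simp only [Nat.sub_self, pow_zero, Nat.choose_self, Nat.cast_one, mul_one] at c0
  have d1 : l1 * e1 + l2 * e2 + l3 * e3 = 0 := by
    apply mul_left_cancel₀ n1
    linear_combination -c1
  have d2 : l1 * e1 ^ 2 + l2 * e2 ^ 2 + l3 * e3 ^ 2 = 0 := by
    apply mul_left_cancel₀ n2
    linear_combination c2
  have : l1 * ((e1 - e2) * (e1 - e3)) = 0 := by
    linear_combination d2 - (e2 + e3) * d1 + e2 * e3 * c0
  rcases mul_eq_zero.mp this with h | h
  · exact h
  · exact absurd h (mul_ne_zero (sub_ne_zero.mpr h12) (sub_ne_zero.mpr h13))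

theorem GG_eq_smul {F : Type*} [Field F] {d : ℕ} (a b : Fin (d + 1) → F) (v : Fin 2 → F) (z : F)
    (h : hev a v = z * hev b v) : GG a b v = hev b v • ![z, 1] := by
  ext i; fin_cases i
  · simp [GG, h]; ring
  · simp [GG]

open Polynomial in
theorem inf_aux {L : Type*} [Field L] [CharZero L] [IsAlgClosed L] {d : ℕ} (hd : 2 ≤ d)
    (a b : Fin (d + 1) → L) (hg : GoodV a b) (hinf : ¬ PreV a b ![1, 0]) :
    {z : L | PreV a b ![z, 1]}.Infinite := by
  intro hfin
  have hd0 : d ≠ 0 := by omega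
  set E := {z : L | PreV a b ![z, 1]} with hE
  have hnb : ∀ z ∈ E, hev b ![z, 1] ≠ 0 := by
    intro z hz h0
    apply hinf
    have h1 := PreV_GG a b hd0 hz
    refine PreV_wdg a b (hg _ vec_one_ne) ?_ h1
    simp [wdg, GG, h0]
  have hpre : ∀ e z, z ∈ E → hev a ![e, 1] = z * hev b ![e, 1] → e ∈ E := by
    intro e z hz h
    apply PreV_of_GG
    rw [GG_eq_smul a b _ z h]
    exact PreV_smul _ _ _ _ hz
  have hlead : ∀ z ∈ E, hev a ![1, 0] - z * hev b ![1, 0] ≠ 0 := by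
    intro z hz h
    apply hinf
    apply PreV_of_GG
    rw [GG_eq_smul a b _ z (sub_eq_zero.mp h)]
    exact PreV_smul _ _ _ _ hz
  let Q : L → Polynomial L := fun z => pol a - Polynomial.C z * pol b
  have hQc : ∀ z, (Q z).coeff d = hev a ![1, 0] - z * hev b ![1, 0] := by
    intro z; simp [Q, pol_coeff]
  have hQd : ∀ z ∈ E, (Q z).natDegree = d := by
    intro z hz
    apply le_antisymm
    · refine (natDegree_sub_le _ _).trans (max_le (pol_natDegree a) ?_)
      exact (natDegree_C_mul_le _ _).trans (pol_natDegree b)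
    · apply le_natDegree_of_ne_zero
      rw [hQc]; exact hlead z hz
  have hQe : ∀ z e, (Q z).eval e = 0 ↔ hev a ![e, 1] = z * hev b ![e, 1] := by
    intro z e; simp [Q, pol_eval, sub_eq_zero]
  let φ : L → L := fun e => hev a ![e, 1] / hev b ![e, 1]
  have hφ : ∀ e ∈ E, hev a ![e, 1] = φ e * hev b ![e, 1] := by
    intro e he; have := hnb e he; simp only [φ]; field_simp
  have hmaps : ∀ e ∈ E, φ e ∈ E := by
    intro e he
    have h1 := PreV_GG a b hd0 he
    refine PreV_wdg a b (hg _ vec_one_ne) ?_ h1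
    rw [GG_eq_smul a b _ _ (hφ e he), wdg_smul_left, wdg_self, mul_zero]
  have hφeq : ∀ e z, z ∈ E → hev a ![e, 1] = z * hev b ![e, 1] → φ e = z := by
    intro e z hz h
    have := hnb e (hpre e z hz h)
    simp only [φ]; rw [h]; field_simp
  have hsurj : ∀ z ∈ E, ∃ e ∈ E, φ e = z := by
    intro z hz
    have : (Q z).degree ≠ 0 := by
      intro h; have h' := natDegree_eq_of_degree_eq_some h; rw [hQd z hz] at h'; exact hd0 h'
    obtain ⟨e, he⟩ := IsAlgClosed.exists_root (Q z) this
    have h1 := (hQe z e).mp he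
    exact ⟨e, hpre e z hz h1, hφeq e z hz h1⟩
  have hinj : Set.InjOn φ E := by
    have := Finset.injOn_of_surjOn_of_card_le (s := hfin.toFinset) (t := hfin.toFinset) φ
      (by intro e he; simp only [Set.Finite.coe_toFinset] at he ⊢; exact hmaps e he)
      (by intro z hz; simp only [Set.Finite.coe_toFinset] at hz ⊢; obtain ⟨e, h1, h2⟩ := hsurj z hz; exact ⟨e, h1, h2⟩)
      le_rfl
    simpa using this
  have htot : ∀ e ∈ E, φ e = e → ∃ c, c ≠ 0 ∧ pol a - Polynomial.C e * pol b = Polynomial.C c * (Polynomial.X - Polynomial.C e) ^ d := by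
    intro e he hfe
    have hs := IsAlgClosed.splits (Q e)
    have h1 : (Q e).roots = Multiset.replicate d e := by
      rw [Multiset.eq_replicate]
      refine ⟨by rw [← hs.natDegree_eq_card_roots, hQd e he], ?_⟩
      intro x hx
      have h2 := (hQe e x).mp (isRoot_of_mem_roots hx)
      have h3 := hφeq x e he h2
      exact hinj (hpre x e he h2) he (h3.trans hfe.symm)
    refine ⟨(Q e).leadingCoeff, ?_, ?_⟩
    · rw [leadingCoeff, hQd e he, hQc]; exact hlead e he
    · have h4 := hs.eq_prod_roots
      rw [h1] at h4
      simpa using h4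
  let P : Polynomial L := Polynomial.X * pol b - pol a
  have hbd : hev b ![1, 0] ≠ 0 := by
    intro h
    apply hinf
    refine ⟨1, 0, by omega, ?_⟩
    simp [wdg, GG, h]
  have hPd : P.natDegree = d + 1 := by
    apply le_antisymm
    · refine (natDegree_sub_le _ _).trans (max_le ?_ ((pol_natDegree a).trans (by omega)))
      refine natDegree_mul_le.trans ?_
      have := pol_natDegree b
      have := natDegree_X_le (R := L)
      omega
    · apply le_natDegree_of_ne_zero
      have : (pol a).coeff (d + 1) = 0 := coeff_eq_zero_of_natDegree_lt (by have := pol_natDegree a; omega)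
      simp only [P, Polynomial.coeff_sub, Polynomial.coeff_X_mul, pol_coeff, this, sub_zero]
      exact hbd
  have hP0 : P ≠ 0 := by
    intro h; rw [h] at hPd; simp at hPd
  have hroot : ∀ e, e ∈ P.roots → e ∈ E ∧ φ e = e := by
    intro e he
    have h1 : P.eval e = 0 := isRoot_of_mem_roots he
    simp only [P, Polynomial.eval_sub, Polynomial.eval_mul, Polynomial.eval_X, pol_eval] at h1
    have h2 : hev a ![e, 1] = e * hev b ![e, 1] := (sub_eq_zero.mp h1).symm
    have h3 : e ∈ E := by
      refine ⟨1, 0, by omega, ?_⟩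
      simp only [Function.iterate_one, Function.iterate_zero, id]
      rw [GG_eq_smul a b _ _ h2, wdg_smul_left, wdg_self, mul_zero]
    exact ⟨h3, hφeq e e h3 h2⟩
  have hnodup : P.roots.Nodup := by
    classical
    rw [Multiset.nodup_iff_count_le_one]
    intro e
    by_cases he : e ∈ P.roots
    · obtain ⟨h1, h2⟩ := hroot e he
      obtain ⟨c, hc, h3⟩ := htot e h1 h2
      rw [count_roots]
      by_contra hlt
      push Not at hlt
      have h4 : (Polynomial.X - Polynomial.C e) ^ 2 ∣ P := (le_rootMultiplicity_iff hP0).mp hlt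
      have hd' : d = (d - 1) + 1 := by omega
      have h5 : P = (Polynomial.X - Polynomial.C e) * (pol b - Polynomial.C c * (Polynomial.X - Polynomial.C e) ^ (d - 1)) := by
        have hpow : (Polynomial.X - Polynomial.C e) ^ d = (Polynomial.X - Polynomial.C e) ^ (d - 1) * (Polynomial.X - Polynomial.C e) := by
          rw [← pow_succ, ← hd']
        simp only [P]
        rw [hpow] at h3
        linear_combination (exp := 1) -h3
      rw [h5, pow_two] at h4
      have h6 := (mul_dvd_mul_iff_left (X_sub_C_ne_zero e)).mp h4
      rw [dvd_iff_isRoot] at h6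
      have h7 : (pol b - Polynomial.C c * (Polynomial.X - Polynomial.C e) ^ (d - 1)).eval e = 0 := h6
      simp only [Polynomial.eval_sub, Polynomial.eval_mul, Polynomial.eval_C, Polynomial.eval_pow, Polynomial.eval_X, sub_self, pol_eval] at h7
      rw [zero_pow (by omega), mul_zero, sub_zero] at h7
      exact hnb e h1 h7
    · rw [Multiset.count_eq_zero_of_notMem he]; omega
  classical
  have hcard : 2 < P.roots.toFinset.card := by
    rw [Multiset.toFinset_card_of_nodup hnodup, ← (IsAlgClosed.splits P).natDegree_eq_card_roots, hPd]
    omega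
  obtain ⟨e1, m1, e2, m2, e3, m3, h12, h13, h23⟩ := Finset.two_lt_card.mp hcard
  rw [Multiset.mem_toFinset] at m1 m2 m3
  obtain ⟨c1, hc1, p1⟩ := htot e1 (hroot _ m1).1 (hroot _ m1).2
  obtain ⟨c2, hc2, p2⟩ := htot e2 (hroot _ m2).1 (hroot _ m2).2
  obtain ⟨c3, hc3, p3⟩ := htot e3 (hroot _ m3).1 (hroot _ m3).2
  have := three_pow hd e1 e2 e3 ((e2 - e3) * c1) ((e3 - e1) * c2) ((e1 - e2) * c3) h12 h13 (by
    simp only [map_mul, map_sub]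
    linear_combination (Polynomial.C e3 - Polynomial.C e2) * p1 + (Polynomial.C e1 - Polynomial.C e3) * p2 + (Polynomial.C e2 - Polynomial.C e1) * p3)
  exact mul_ne_zero (sub_ne_zero.mpr h23) hc1 this

theorem exists_compl {L : Type*} [Field L] (q : Fin 2 → L) (hq : q ≠ 0) : ∃ r : Fin 2 → L, wdg q r = 1 := by
  by_cases h : q 0 = 0
  · have h1 : q 1 ≠ 0 := by
      intro h1; apply hq; ext i; fin_cases i <;> assumption
    exact ⟨![-(q 1)⁻¹, 0], by simp [wdg, h1]⟩
  · exact ⟨![0, (q 0)⁻¹], by simp [wdg, h]⟩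

theorem inf_thm {L : Type*} [Field L] [CharZero L] [IsAlgClosed L] {d : ℕ} (hd : 2 ≤ d)
    (a b : Fin (d + 1) → L) (hg : GoodV a b) :
    {z : L | PreV a b ![z, 1]}.Infinite := by
  by_cases hall : ∀ q : Fin 2 → L, q ≠ 0 → PreV a b q
  · have : {z : L | PreV a b ![z, 1]} = Set.univ := by
      ext z; simp; exact hall _ vec_one_ne
    rw [this]
    have : Infinite L := IsAlgClosed.instInfinite
    exact Set.infinite_univ
  push Not at hall
  obtain ⟨q, hq, hqp⟩ := hall
  obtain ⟨r, hr⟩ := exists_compl q hq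
  let P : (Fin 2 → L) → (Fin 2 → L) := fun w => w 0 • q + w 1 • r
  have hPw : ∀ v w, wdg (P v) (P w) = wdg v w := by
    intro v w
    have : wdg (P v) (P w) = wdg v w * wdg q r := by simp [wdg, P]; ring
    rw [this, hr, mul_one]
  have hPinj : ∀ v, P v = 0 → v = 0 := by
    intro v hv
    have h0 : wdg (P v) r = v 0 * wdg q r := by simp [wdg, P]; ring
    have h1 : wdg q (P v) = v 1 * wdg q r := by simp [wdg, P]; ring
    rw [hv, hr] at h0 h1
    simp [wdg] at h0 h1
    ext i; fin_cases i
    · exact h0.symm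
    · exact h1.symm
  have hfa := IsForm.subst a q r
  have hfb := IsForm.subst b q r
  obtain ⟨a', ha'⟩ := (hfa.smul (r 1)).add (hfb.smul (-(r 0)))
  obtain ⟨b', hb'⟩ := (hfb.smul (q 0)).add (hfa.smul (-(q 1)))
  have hr' : q 0 * r 1 - q 1 * r 0 = 1 := hr
  have hsemi : Function.Semiconj P (GG a' b') (GG a b) := by
    intro w
    ext i
    have e1 := ha' w
    have e2 := hb' w
    simp only at e1 e2
    fin_cases i
    · simp only [P, GG, e1, e2]
      simp
      linear_combination (hev a (w 0 • q + w 1 • r)) * hr'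
    · simp only [P, GG, e1, e2]
      simp
      linear_combination (hev b (w 0 • q + w 1 • r)) * hr'
  have hpre : ∀ w, PreV a' b' w ↔ PreV a b (P w) := by
    intro w
    unfold PreV
    simp only [← (hsemi.iterate_right _).eq, hPw]
  have hg' : GoodV a' b' := by
    intro v hv h
    have h1 := hsemi v
    rw [h] at h1
    have : P 0 = 0 := by simp [P]
    rw [this] at h1
    exact hg _ (fun h => hv (hPinj v h)) h1.symm
  have hinf := inf_aux hd a' b' hg' (by
    rw [hpre]
    have : P ![1, 0] = q := by simp [P]
    rw [this]; exact hqp)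
  -- transfer
  have h1 : ({z : L | PreV a' b' ![z, 1]} \ {z | z * q 1 + r 1 = 0}).Infinite := by
    refine hinf.sdiff ?_
    refine Set.Subsingleton.finite ?_
    intro x hx y hy
    simp only [Set.mem_ofPred_eq] at hx hy
    have hq1 : q 1 ≠ 0 := by
      intro h
      rw [h] at hx hr'
      simp at hx
      simp [hx] at hr'
    have : (x - y) * q 1 = 0 := by linear_combination hx - hy
    exact sub_eq_zero.mp ((mul_eq_zero.mp this).resolve_right hq1)
  refine Set.Infinite.mono ?_ (h1.image (f := fun z => (z * q 0 + r 0) / (z * q 1 + r 1)) ?_)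
  · rintro _ ⟨z, ⟨hz, hne⟩, rfl⟩
    have hne' : z * q 1 + r 1 ≠ 0 := hne
    have h2 := (hpre _).mp hz
    refine PreV_wdg a b (fun h => vec_one_ne (hPinj _ h)) ?_ h2
    simp [wdg, P]
    field_simp
    ring
  · rintro x ⟨_, hx⟩ y ⟨_, hy⟩ hxy
    have hx' : x * q 1 + r 1 ≠ 0 := hx
    have hy' : y * q 1 + r 1 ≠ 0 := hy
    simp only at hxy
    rw [div_eq_div_iff hx' hy'] at hxy
    linear_combination hxy - (x - y) * hr'

open Polynomial in
theorem descent {k L : Type*} [Field k] [IsAlgClosed k] [Field L] [Algebra k L] {d : ℕ}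
    (a b : Fin (d + 1) → L) (C : Set k) (hC : C.Infinite)
    (h : ∀ c ∈ C, ∃ c' : k, hev a ![algebraMap k L c, 1] = algebraMap k L c' * hev b ![algebraMap k L c, 1])
    (z : L) (c' : k) (hz : hev a ![z, 1] = algebraMap k L c' * hev b ![z, 1]) (hbz : hev b ![z, 1] ≠ 0)
    (hzk : z ∉ Set.range (algebraMap k L)) : ∀ j, a j = algebraMap k L c' * b j := by
  have key : ∀ φ : L →ₗ[k] k, ∀ j, φ (a j) = c' * φ (b j) := by
    intro φ
    have hφ : ∀ (x : Fin (d + 1) → L) (c : k), φ (hev x ![algebraMap k L c, 1]) = hev (fun j => φ (x j)) ![c, 1] := by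
      intro x c
      simp only [hev, map_sum]
      refine Finset.sum_congr rfl fun j _ => ?_
      simp only [Matrix.cons_val_zero, Matrix.cons_val_one, one_pow, mul_one]
      rw [← map_pow, mul_comm, ← Algebra.smul_def, map_smul, smul_eq_mul, mul_comm]
    have hm : ∀ (x : Fin (d + 1) → k) (y : L), ((pol x).map (algebraMap k L)).eval y = hev (fun j => algebraMap k L (x j)) ![y, 1] := by
      intro x y
      rw [← pol_eval]
      simp [pol, Polynomial.map_sum]
    have h1 : pol a * (pol (fun j => φ (b j))).map (algebraMap k L) - pol b * (pol (fun j => φ (a j))).map (algebraMap k L) = 0 := by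
      refine Polynomial.eq_zero_of_infinite_isRoot _ (Set.Infinite.mono ?_ (hC.image (f := algebraMap k L) (algebraMap k L).injective.injOn))
      rintro _ ⟨c, hc, rfl⟩
      obtain ⟨e, he⟩ := h c hc
      have he2 := congrArg φ he
      rw [hφ, ← Algebra.smul_def, map_smul, smul_eq_mul, hφ] at he2
      simp only [Set.mem_ofPred_eq, IsRoot.def, Polynomial.eval_sub, Polynomial.eval_mul, pol_eval, Polynomial.eval_map_algebraMap, Polynomial.aeval_algebraMap_apply, Polynomial.coe_aeval_eq_eval]
      rw [he, he2, map_mul]; ring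
    have h2 := congrArg (Polynomial.eval z) h1
    simp only [Polynomial.eval_sub, Polynomial.eval_mul, pol_eval, Polynomial.eval_zero, hz] at h2
    have h3 : Polynomial.aeval z (Polynomial.C c' * pol (fun j => φ (b j)) - pol (fun j => φ (a j))) = 0 := by
      apply mul_left_cancel₀ hbz
      rw [map_sub, map_mul, Polynomial.aeval_C, ← Polynomial.eval_map_algebraMap, ← Polynomial.eval_map_algebraMap]
      linear_combination h2
    have h4 : Polynomial.C c' * pol (fun j => φ (b j)) - pol (fun j => φ (a j)) = 0 := by
      by_contra hne
      exact hzk (const_of_alg z ⟨_, hne, h3⟩)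
    intro j
    have h5 := congrArg (fun p => Polynomial.coeff p (j : ℕ)) h4
    have hcf : ∀ x : Fin (d + 1) → k, (pol x).coeff (j : ℕ) = x j := by
      intro x
      simp only [pol, Polynomial.finsetSum_coeff, Polynomial.coeff_C_mul, Polynomial.coeff_X_pow]
      rw [Finset.sum_eq_single j]
      · simp
      · intro i _ hi
        have : (j : ℕ) ≠ i := fun h => hi (Fin.ext h.symm)
        simp [this]
      · simp
    simp only [Polynomial.coeff_sub, Polynomial.coeff_C_mul, hcf, Polynomial.coeff_zero] at h5
    exact (sub_eq_zero.mp h5).symm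
  intro j
  rw [← sub_eq_zero, ← Module.forall_dual_apply_eq_zero_iff k]
  intro φ
  rw [map_sub, key φ j, ← Algebra.smul_def, map_smul, smul_eq_mul, sub_self]

theorem hev_smul_coef {R : Type*} [CommRing R] {d : ℕ} (c : R) (a b : Fin (d + 1) → R) (h : ∀ j, a j = c * b j)
    (v : Fin 2 → R) : hev a v = c * hev b v := by
  unfold hev
  rw [Finset.mul_sum]
  refine Finset.sum_congr rfl fun j _ => ?_
  rw [h]; ring

theorem wdg_dec {R : Type*} [CommRing R] (p q v : Fin 2 → R) (u : R) (h : u * wdg v p + wdg v q = 0) :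
    (wdg p q) • v = (- wdg v p) • (u • p + q) := by
  ext i
  fin_cases i
  · simp [wdg] at h ⊢
    linear_combination p 0 * h
  · simp [wdg] at h ⊢
    linear_combination p 1 * h

theorem main_const {k L : Type*} [Field k] [CharZero k] [IsAlgClosed k] [Field L] [Algebra k L]
    (h2 : ∀ x : Option (Fin 1) → L, ¬ AlgebraicIndependent k x) (R : Subalgebra k L) (hR : R.FG)
    {d : ℕ} (a b : Fin (d + 1) → R) (p0 p1 v : Fin 2 → R) (hp : IsUnit (wdg p0 p1))
    (H0 : PreV a b p0) (H1 : PreV a b p1) (H01 : PreV a b (p0 + p1))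
    (hnp : ∀ χ : R →ₐ[k] k, ¬ PreV (fun j => χ (a j)) (fun j => χ (b j)) (fun j => χ (v j))) :
    (∃ c : k, wdg (fun i => (v i : L)) (fun i => algebraMap k L c * p0 i + p1 i) = 0) ∧
    {c : k | ∃ c' : k, wdg (GG (fun j => (a j : L)) (fun j => (b j : L)) (fun i => algebraMap k L c * p0 i + p1 i))
      (fun i => algebraMap k L c' * p0 i + p1 i) = 0}.Infinite := by
  have hft : Algebra.FiniteType k R := R.fg_iff_finiteType.mp hR
  set V : ℕ → Fin 2 → R := fun n => (GG a b)^[n] v with hV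
  have hVs : ∀ n, V (n + 1) = GG a b (V n) := fun n => Function.iterate_succ_apply' _ _ _
  have hun : ∀ q : Fin 2 → R, PreV a b q → (∀ χ : R →ₐ[k] k, (fun i => χ (q i)) ≠ 0) → ∀ n, IsUnit (wdg (V n) q) := by
    intro q hq hq0 n
    refine nullst_unit (k := k) _ fun χ hχ => ?_
    apply hnp χ
    have e1 := wdg_map χ.toRingHom (V n) q
    have e1' : wdg (fun i => χ (V n i)) (fun i => χ (q i)) = 0 := e1.trans hχ
    rw [wdg_swap, neg_eq_zero] at e1'
    have e2 := PreV_wdg _ _ (hq0 χ) e1' (PreV_map a b χ.toRingHom q hq)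
    have e3 := GG_iter_map a b χ.toRingHom v n
    apply PreV_of_iter _ _ _ n
    have e4 : (GG (fun j => χ (a j)) (fun j => χ (b j)))^[n] (fun j => χ (v j)) = fun i => χ (V n i) := e3
    rw [e4]
    exact e2
  have hD : ∀ χ : R →ₐ[k] k, wdg (fun i => χ (p0 i)) (fun i => χ (p1 i)) ≠ 0 := by
    intro χ
    have e := wdg_map χ.toRingHom p0 p1
    have e' : wdg (fun i => χ (p0 i)) (fun i => χ (p1 i)) = χ (wdg p0 p1) := e
    rw [e']
    exact (hp.map χ).ne_zero
  have U0 := hun p0 H0 (fun χ h => hD χ (by rw [h]; simp [wdg]))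
  have U1 := hun p1 H1 (fun χ h => hD χ (by rw [h]; simp [wdg]))
  have U01 := hun (p0 + p1) H01 (fun χ h => hD χ (by
    have h0 := congrFun h 0
    have h1 := congrFun h 1
    simp at h0 h1
    simp only [wdg]
    linear_combination χ (p0 0) * h1 - χ (p0 1) * h0))
  choose w hw using fun n => (U0 n).exists_right_inv
  let u : ℕ → R := fun n => - wdg (V n) p1 * w n
  have hu0 : ∀ n, u n * wdg (V n) p0 + wdg (V n) p1 = 0 := by
    intro n
    simp only [u]
    linear_combination (- wdg (V n) p1) * hw n
  have hw0 : ∀ n, IsUnit (w n) := fun n => IsUnit.of_mul_eq_one (wdg (V n) p0) (by rw [mul_comm]; exact hw n)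
  have hunit : ∀ n, IsUnit (u n) := fun n => (U1 n).neg.mul (hw0 n)
  have hunit1 : ∀ n, IsUnit (1 - u n) := by
    intro n
    have : 1 - u n = wdg (V n) (p0 + p1) * w n := by
      rw [wdg_add_right]; simp only [u]; linear_combination - hw n
    rw [this]
    exact (U01 n).mul (hw0 n)
  have hdec : ∀ n, (wdg p0 p1) • V n = (- wdg (V n) p0) • (u n • p0 + p1) := by
    intro n
    exact wdg_dec _ _ _ _ (hu0 n)
  obtain ⟨χ0⟩ : Nonempty (R →ₐ[k] k) := nullst
  have hdist' : ∀ n m, m < n → u n ≠ u m := by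
    intro n m hnm h
    refine hnp χ0 (PreV_map a b χ0.toRingHom v ⟨n, m, hnm, ?_⟩)
    have e1 : wdg ((wdg p0 p1) • V n) ((wdg p0 p1) • V m) = 0 := by
      rw [hdec n, hdec m, h, wdg_smul_left, wdg_smul_right, wdg_self, mul_zero, mul_zero]
    rw [wdg_smul_left, wdg_smul_right] at e1
    exact hp.mul_right_eq_zero.mp (hp.mul_right_eq_zero.mp e1)
  have hinj : Function.Injective u := by
    intro n m h
    rcases lt_trichotomy n m with h1 | h1 | h1
    · exact absurd h.symm (hdist' m n h1)
    · exact h1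
    · exact absurd h (hdist' n m h1)
  have hfin : {n | (u n : L) ∉ Set.range (algebraMap k L)}.Finite := by
    have := (unit_thm h2 R hR).preimage (f := u) hinj.injOn
    refine this.subset ?_
    intro n hn
    exact ⟨hn, hunit n, hunit1 n⟩
  obtain ⟨n0, hn0⟩ : ∃ n0, ∀ n, n0 ≤ n → (u n : L) ∈ Set.range (algebraMap k L) := by
    obtain ⟨M, hM⟩ := hfin.bddAbove
    refine ⟨M + 1, fun n hn => ?_⟩
    by_contra h
    have := hM h
    omega
  -- over L
  have hdL : ∀ x : R, algebraMap R L x = (x : L) := fun x => rfl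
  let aL : Fin (d + 1) → L := fun j => a j
  let bL : Fin (d + 1) → L := fun j => b j
  let q0 : Fin 2 → L := fun j => p0 j
  let q1 : Fin 2 → L := fun j => p1 j
  let x : ℕ → Fin 2 → L := fun n => (u n : L) • q0 + q1
  let VL : ℕ → Fin 2 → L := fun n i => V n i
  have hVL : ∀ n, VL (n + 1) = GG aL bL (VL n) := by
    intro n
    have e := GG_map a b (algebraMap R L) (V n)
    simp only [VL, hVs]
    exact e.symm
  have hDL : wdg q0 q1 ≠ 0 := by
    have e := wdg_map (algebraMap R L) p0 p1
    have e' : wdg q0 q1 = algebraMap R L (wdg p0 p1) := e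
    rw [e']
    exact (hp.map (algebraMap R L)).ne_zero
  have hE : ∀ n, wdg (VL n) q0 ≠ 0 := by
    intro n
    have e : wdg (VL n) q0 = algebraMap R L (wdg (V n) p0) := wdg_map (algebraMap R L) (V n) p0
    rw [e]
    exact ((U0 n).map (algebraMap R L)).ne_zero
  have hdecL : ∀ n, (wdg q0 q1) • VL n = (- wdg (VL n) q0) • x n := by
    intro n
    ext i
    have e := congrArg (algebraMap R L) (congrFun (hdec n) i)
    simp only [Pi.smul_apply, Pi.add_apply, smul_eq_mul, map_mul, map_neg, map_add] at e
    rw [← wdg_map (algebraMap R L), ← wdg_map (algebraMap R L)] at e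
    exact e
  have hVx : ∀ n, wdg (VL n) (x n) = 0 := by
    intro n
    have e : wdg ((wdg q0 q1) • VL n) (x n) = 0 := by
      rw [hdecL, wdg_smul_left, wdg_self, mul_zero]
    rw [wdg_smul_left] at e
    exact (mul_eq_zero.mp e).resolve_left hDL
  have hGx : ∀ n, wdg q0 q1 ^ d • VL (n + 1) = (- wdg (VL n) q0) ^ d • GG aL bL (x n) := by
    intro n
    rw [hVL, ← GG_smul, hdecL, GG_smul]
  have hGxx : ∀ n, wdg (GG aL bL (x n)) (x (n + 1)) = 0 := by
    intro n
    have e : wdg (wdg q0 q1 ^ d • VL (n + 1)) (x (n + 1)) = 0 := by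
      rw [wdg_smul_left, hVx, mul_zero]
    rw [hGx, wdg_smul_left] at e
    exact (mul_eq_zero.mp e).resolve_left (pow_ne_zero _ (neg_ne_zero.mpr (hE n)))
  have hGp : ∀ n, wdg (GG aL bL (x n)) q0 ≠ 0 := by
    intro n h
    have e : wdg ((- wdg (VL n) q0) ^ d • GG aL bL (x n)) q0 = 0 := by
      rw [wdg_smul_left, h, mul_zero]
    rw [← hGx, wdg_smul_left] at e
    exact (mul_ne_zero (pow_ne_zero _ hDL) (hE (n + 1))) e
  have hfa := IsForm.subst aL q0 q1
  have hfb := IsForm.subst bL q0 q1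
  obtain ⟨α, hα⟩ := (hfa.smul (q1 1)).add (hfb.smul (-(q1 0)))
  obtain ⟨β, hβ⟩ := (hfa.smul (-(q0 1))).add (hfb.smul (q0 0))
  have hα' : ∀ z : L, hev α ![z, 1] = wdg (GG aL bL (z • q0 + q1)) q1 := by
    intro z; rw [hα]; simp [wdg, GG]; ring
  have hβ' : ∀ z : L, hev β ![z, 1] = - wdg (GG aL bL (z • q0 + q1)) q0 := by
    intro z; rw [hβ]; simp [wdg, GG]; ring
  have hrel : ∀ n, hev α ![(u n : L), 1] = (u (n + 1) : L) * hev β ![(u n : L), 1] := by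
    intro n
    rw [hα', hβ']
    have e := hGxx n
    simp only [x] at e
    rw [wdg_add_right, wdg_smul_right] at e
    linear_combination e
  have hβn : ∀ n, hev β ![(u n : L), 1] ≠ 0 := by
    intro n; rw [hβ']; exact neg_ne_zero.mpr (hGp n)
  let C : Set k := {c | ∃ n, n0 ≤ n ∧ algebraMap k L c = u n}
  have hC : C.Infinite := by
    have hi : (Set.Ici n0).Infinite := Set.Ici_infinite n0
    have h1 := hi.image (f := fun n => (u n : L)) (fun n _ m _ h => hinj (Subtype.ext h))
    refine Set.Infinite.of_image (algebraMap k L) (h1.mono ?_)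
    rintro _ ⟨n, hn, rfl⟩
    obtain ⟨c, hc⟩ := hn0 n hn
    exact ⟨c, ⟨n, hn, hc⟩, hc⟩
  have hdesc : ∀ n, (u (n + 1) : L) ∈ Set.range (algebraMap k L) → (u n : L) ∈ Set.range (algebraMap k L) := by
    intro n ⟨c', hc'⟩
    by_contra hn
    have := descent α β C hC (by
      rintro c ⟨m, hm, hc⟩
      obtain ⟨e, he⟩ := hn0 (m + 1) (by omega)
      refine ⟨e, ?_⟩
      rw [hc, he]; exact hrel m) (u n) c' (by rw [hc']; exact hrel n) (hβn n) hn
    have key : ∀ m, (u (m + 1) : L) = algebraMap k L c' := by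
      intro m
      apply mul_right_cancel₀ (hβn m)
      rw [← hrel m, hev_smul_coef _ _ _ this]
    have := hinj (Subtype.ext ((key 0).trans (key 1).symm))
    omega
  have hall : ∀ n, (u 0 : L) ∈ Set.range (algebraMap k L) ∨ (u n : L) ∉ Set.range (algebraMap k L) := by
    intro n
    induction n with
    | zero => exact em _
    | succ n ih =>
      rcases ih with h | h
      · exact Or.inl h
      · exact Or.inr fun h' => h (hdesc n h')
  obtain ⟨c, hc⟩ := (hall n0).resolve_right (fun h => h (hn0 n0 le_rfl))
  refine ⟨⟨c, ?_⟩, hC.mono ?_⟩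
  · have := hVx 0
    rw [hc]; exact this
  · rintro c ⟨n, hn, hc⟩
    obtain ⟨e, he⟩ := hn0 (n + 1) (by omega)
    refine ⟨e, ?_⟩
    rw [hc, he]; exact hGxx n

theorem IsForm.mul {F : Type*} [Field F] {d e : ℕ} {h h' : (Fin 2 → F) → F} (H : IsForm d h) (H' : IsForm e h') :
    IsForm (d + e) (fun v => h v * h' v) := by
  obtain ⟨b, hb⟩ := H'
  have h1 : IsForm (d + e) (fun v => ∑ j : Fin (e + 1), b j * ((v 0 * 0 + v 1 * 1) ^ (e - (j:ℕ)) * ((v 0 * 1 + v 1 * 0) ^ (j:ℕ) * h v))) := by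
    refine IsForm.sum _ _ fun j => IsForm.smul _ ?_
    have h2 := (H.mulPow 1 0 j).mulPow 0 1 (e - j)
    have : d + (j:ℕ) + (e - j) = d + e := by omega
    rw [this] at h2
    exact h2
  obtain ⟨a, ha⟩ := h1
  refine ⟨a, fun v => ?_⟩
  rw [ha]
  simp only
  rw [← hb, hev, Finset.mul_sum]
  refine Finset.sum_congr rfl fun j _ => ?_
  ring

theorem form_zero {F : Type*} [Field F] {n : ℕ} {h : (Fin 2 → F) → F} (H : IsForm n h) (c : Fin (n + 1) → F)
    (hc : Function.Injective c) (hz : ∀ j, h ![c j, 1] = 0) (v : Fin 2 → F) : h v = 0 := by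
  obtain ⟨a, ha⟩ := H
  have h1 : pol a = 0 := by
    refine Polynomial.eq_zero_of_natDegree_lt_card_of_eval_eq_zero _ hc (fun j => ?_) ?_
    · rw [pol_eval, ha, hz]
    · simp only [Fintype.card_fin]
      exact Nat.lt_succ_of_le (pol_natDegree a)
  have h2 : ∀ j, a j = 0 := by
    intro j
    have h5 := congrArg (fun p => Polynomial.coeff p (j : ℕ)) h1
    simp only [pol, Polynomial.finsetSum_coeff, Polynomial.coeff_C_mul, Polynomial.coeff_X_pow, Polynomial.coeff_zero] at h5
    rw [Finset.sum_eq_single j] at h5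
    · simpa using h5
    · intro i _ hi
      have : (j : ℕ) ≠ i := fun h => hi (Fin.ext h.symm)
      simp [this]
    · simp
  rw [← ha]
  simp [hev, h2]

def linE {F : Type*} [Field F] (p q p' q' : Fin 2 → F) (h : wdg p q ≠ 0) (h' : wdg p' q' ≠ 0) :
    (Fin 2 → F) ≃ₗ[F] (Fin 2 → F) where
  toFun v := (wdg p q)⁻¹ • (wdg v q • p' + wdg p v • q')
  invFun v := (wdg p' q')⁻¹ • (wdg v q' • p + wdg p' v • q)
  map_add' v w := by
    rw [wdg_add_left, wdg_add_right]; module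
  map_smul' c v := by
    rw [wdg_smul_left, wdg_smul_right]; simp only [RingHom.id_apply]; module
  left_inv v := by
    have h1 : wdg ((wdg p q)⁻¹ • (wdg v q • p' + wdg p v • q')) q' = (wdg p q)⁻¹ * wdg v q * wdg p' q' := by
      rw [wdg_smul_left, wdg_add_left, wdg_smul_left, wdg_smul_left, wdg_self]; ring
    have h2 : wdg p' ((wdg p q)⁻¹ • (wdg v q • p' + wdg p v • q')) = (wdg p q)⁻¹ * wdg p v * wdg p' q' := by
      rw [wdg_smul_right, wdg_add_right, wdg_smul_right, wdg_smul_right, wdg_self]; ring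
    have h3 : wdg v q • p + wdg p v • q = wdg p q • v := by
      ext i; fin_cases i <;> simp [wdg] <;> ring
    simp only [h1, h2]
    rw [show ((wdg p q)⁻¹ * wdg v q * wdg p' q') • p + ((wdg p q)⁻¹ * wdg p v * wdg p' q') • q
      = (wdg p' q') • (wdg p q)⁻¹ • (wdg v q • p + wdg p v • q) by module, h3,
      inv_smul_smul₀ h', inv_smul_smul₀ h]
  right_inv v := by
    have h1 : wdg ((wdg p' q')⁻¹ • (wdg v q' • p + wdg p' v • q)) q = (wdg p' q')⁻¹ * wdg v q' * wdg p q := by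
      rw [wdg_smul_left, wdg_add_left, wdg_smul_left, wdg_smul_left, wdg_self]; ring
    have h2 : wdg p ((wdg p' q')⁻¹ • (wdg v q' • p + wdg p' v • q)) = (wdg p' q')⁻¹ * wdg p' v * wdg p q := by
      rw [wdg_smul_right, wdg_add_right, wdg_smul_right, wdg_smul_right, wdg_self]; ring
    have h3 : wdg v q' • p' + wdg p' v • q' = wdg p' q' • v := by
      ext i; fin_cases i <;> simp [wdg] <;> ring
    simp only [h1, h2]
    rw [show ((wdg p' q')⁻¹ * wdg v q' * wdg p q) • p' + ((wdg p' q')⁻¹ * wdg p' v * wdg p q) • q'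
      = (wdg p q) • (wdg p' q')⁻¹ • (wdg v q' • p' + wdg p' v • q') by module, h3,
      inv_smul_smul₀ h, inv_smul_smul₀ h']

theorem linE_p {F : Type*} [Field F] (p q p' q' : Fin 2 → F) (h : wdg p q ≠ 0) (h' : wdg p' q' ≠ 0) :
    linE p q p' q' h h' p = p' := by
  change (wdg p q)⁻¹ • (wdg p q • p' + wdg p p • q') = p'
  rw [wdg_self, zero_smul, add_zero, inv_smul_smul₀ h]

theorem linE_q {F : Type*} [Field F] (p q p' q' : Fin 2 → F) (h : wdg p q ≠ 0) (h' : wdg p' q' ≠ 0) :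
    linE p q p' q' h h' q = q' := by
  change (wdg p q)⁻¹ • (wdg q q • p' + wdg p q • q') = q'
  rw [wdg_self, zero_smul, zero_add, inv_smul_smul₀ h]

theorem conj_lemma {F : Type*} [Field F] {d : ℕ} (a b a' b' : Fin (d + 1) → F) (p q p' q' : Fin 2 → F)
    (h : wdg p q ≠ 0) (h' : wdg p' q' ≠ 0) (c e : Fin (d + d + 1) → F) (hc : Function.Injective c)
    (h1 : ∀ j, wdg (GG a b (c j • p + q)) (e j • p + q) = 0)
    (h2 : ∀ j, wdg (GG a' b' (c j • p' + q')) (e j • p' + q') = 0) (v : Fin 2 → F) :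
    wdg (linE p q p' q' h h' (GG a b v)) (GG a' b' (linE p q p' q' h h' v)) = 0 := by
  set M := linE p q p' q' h h' with hM
  have hMp : M p = p' := linE_p ..
  have hMq : M q = q' := linE_q ..
  have hF1 : ∀ i, IsForm d (fun w => M (GG a b (w 0 • p + w 1 • q)) i) := by
    intro i
    have hfa := IsForm.subst a p q
    have hfb := IsForm.subst b p q
    obtain ⟨r, hr⟩ := (hfa.smul (M ![1, 0] i)).add (hfb.smul (M ![0, 1] i))
    refine ⟨r, fun w => ?_⟩
    rw [hr]
    have : GG a b (w 0 • p + w 1 • q) = hev a (w 0 • p + w 1 • q) • ![1, 0] + hev b (w 0 • p + w 1 • q) • ![0, 1] := by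
      ext i; fin_cases i <;> simp [GG]
    beta_reduce
    rw [this, map_add, map_smul, map_smul]
    simp only [Pi.add_apply, Pi.smul_apply, smul_eq_mul]; ring
  have hF2 : ∀ i, IsForm d (fun w => GG a' b' (w 0 • p' + w 1 • q') i) := by
    intro i
    fin_cases i
    · exact IsForm.subst a' p' q'
    · exact IsForm.subst b' p' q'
  have hF : IsForm (d + d) (fun w => wdg (M (GG a b (w 0 • p + w 1 • q))) (GG a' b' (w 0 • p' + w 1 • q'))) := by
    obtain ⟨r, hr⟩ := ((hF1 0).mul (hF2 1)).add (((hF1 1).mul (hF2 0)).smul (-1))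
    exact ⟨r, fun w => by rw [hr]; simp only [wdg]; ring⟩
  have hyn : ∀ (x : F) (p q : Fin 2 → F), wdg p q ≠ 0 → x • p + q ≠ 0 := by
    intro x p q h h0
    apply h
    have : wdg p (x • p + q) = 0 := by rw [h0]; simp [wdg]
    rwa [wdg_add_right, wdg_smul_right, wdg_self, mul_zero, zero_add] at this
  have hz := form_zero hF c hc (fun j => by
    simp only [Matrix.cons_val_zero, Matrix.cons_val_one, one_smul]
    have e1 := h1 j
    rw [wdg_swap, neg_eq_zero] at e1
    obtain ⟨l, hl⟩ := wdg_eq_zero (hyn _ p q h) e1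
    rw [hl, map_smul, map_add, map_smul, hMp, hMq, wdg_smul_left, wdg_swap, h2 j]; simp)
  obtain ⟨w, rfl⟩ : ∃ w : Fin 2 → F, v = w 0 • p + w 1 • q := by
    refine ⟨![(wdg p q)⁻¹ * wdg v q, (wdg p q)⁻¹ * wdg p v], ?_⟩
    have h3 : wdg v q • p + wdg p v • q = wdg p q • v := by
      ext i; fin_cases i <;> simp [wdg] <;> ring
    simp only [Matrix.cons_val_zero, Matrix.cons_val_one, mul_smul]
    rw [← smul_add, h3, inv_smul_smul₀ h]
  have e2 := hz w
  have e3 : M (w 0 • p + w 1 • q) = w 0 • p' + w 1 • q' := by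
    rw [map_add, map_smul, map_smul, hMp, hMq]
  rw [e3]
  exact e2

def cf {R : Type*} [CommRing R] [Algebra ℂ R] {N d : ℕ} (A : Fin (d + 1) → MvPolynomial (Fin N) ℂ) (σ : Fin N → R) :
    Fin (d + 1) → R := fun j => aeval σ (A j)

theorem cf_map {R R' : Type*} [CommRing R] [Algebra ℂ R] [CommRing R'] [Algebra ℂ R'] {N d : ℕ}
    (A : Fin (d + 1) → MvPolynomial (Fin N) ℂ) (σ : Fin N → R) (f : R →ₐ[ℂ] R') :
    (fun j => f (cf A σ j)) = cf A (fun i => f (σ i)) := by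
  ext j
  simp only [cf]
  rw [← AlgHom.comp_apply, comp_aeval]

theorem rel_map {R R' : Type*} [CommRing R] [CommRing R'] {d : ℕ} (f : R →+* R') (a b : Fin (d + 1) → R)
    (p q : Fin 2 → R) (c e : R) :
    f (wdg (GG a b (c • p + q)) (e • p + q)) =
      wdg (GG (fun j => f (a j)) (fun j => f (b j)) (f c • (fun i => f (p i)) + (fun i => f (q i))))
        (f e • (fun i => f (p i)) + (fun i => f (q i))) := by
  have h : ∀ c : R, (f c • (fun i => f (p i)) + (fun i => f (q i))) = fun i => f ((c • p + q) i) := by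
    intro c; ext i; simp
  rw [h, h, GG_map, wdg_map]

def ConjV {d : ℕ} (a b a' b' : Fin (d + 1) → ℂ) (M : (Fin 2 → ℂ) ≃ₗ[ℂ] (Fin 2 → ℂ)) : Prop :=
  ∀ v, wdg (M (GG a b v)) (GG a' b' (M v)) = 0

theorem pick_inj {k : Type*} (n : ℕ) (p : k → k → Prop) (h : {c : k | ∃ c', p c c'}.Infinite) :
    ∃ c c' : Fin n → k, Function.Injective c ∧ ∀ j, p (c j) (c' j) := by
  let c : Fin n → k := fun j => h.natEmbedding _ j
  have hc : ∀ j, ∃ c', p (c j) c' := fun j => (h.natEmbedding _ j).2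
  choose c' hc' using hc
  refine ⟨c, c', ?_, hc'⟩
  intro i j hij
  exact Fin.ext ((h.natEmbedding _).injective (Subtype.ext hij))

theorem diff_prod {R : Type*} [CommRing R] [IsDomain R] {n : ℕ} (c : Fin n → R) (hc : Function.Injective c) :
    ∃ δ : R, δ ≠ 0 ∧ ∀ (f : R →+* ℂ), f δ ≠ 0 → Function.Injective (fun j => f (c j)) := by
  classical
  refine ⟨∏ x ∈ Finset.univ.filter (fun x : Fin n × Fin n => x.1 ≠ x.2), (c x.1 - c x.2), ?_, ?_⟩
  · rw [Finset.prod_ne_zero_iff]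
    intro x hx
    rw [Finset.mem_filter] at hx
    exact sub_ne_zero.mpr fun h => hx.2 (hc h)
  · intro f hf i j hij
    by_contra hne
    rw [map_prod, Finset.prod_ne_zero_iff] at hf
    have := hf (i, j) (by simp [hne])
    apply this
    simp only [map_sub]
    exact sub_eq_zero.mpr hij

theorem iso_thm {k L : Type*} [Field k] [Field L] [Algebra ℂ k] [Algebra ℂ L] [Algebra k L] [IsScalarTower ℂ k L]
    {N d : ℕ} (fa fb ga gb : Fin (d + 1) → MvPolynomial (Fin N) ℂ) (S : Set (Fin N → ℂ))
    (J : Set (MvPolynomial (Fin N) ℂ)) (w : MvPolynomial (Fin N) ℂ)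
    (hS : ∀ s : Fin N → ℂ, (∀ p ∈ J, aeval s p = 0) → aeval s w ≠ 0 → s ∈ S)
    (hmax : ∀ s₀ ∈ S, Set.Finite {s | s ∈ S ∧ ∃ M : (Fin 2 → ℂ) ≃ₗ[ℂ] (Fin 2 → ℂ),
      ConjV (cf fa s₀) (cf fb s₀) (cf fa s) (cf fb s) M ∧ ConjV (cf ga s₀) (cf gb s₀) (cf ga s) (cf gb s) M})
    (σ : Fin N → L) (hJ : ∀ p ∈ J, aeval σ p = 0) (hw : aeval σ w ≠ 0) (i0 : Fin N) (htr : Transcendental k (σ i0))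
    (p0 p1 : Fin 2 → L) (hD : wdg p0 p1 ≠ 0)
    (Hf : {c : k | ∃ c' : k, wdg (GG (cf fa σ) (cf fb σ) (algebraMap k L c • p0 + p1)) (algebraMap k L c' • p0 + p1) = 0}.Infinite)
    (Hg : {c : k | ∃ c' : k, wdg (GG (cf ga σ) (cf gb σ) (algebraMap k L c • p0 + p1)) (algebraMap k L c' • p0 + p1) = 0}.Infinite) :
    False := by
  obtain ⟨c, c', hc, hcc⟩ := pick_inj (d + d + 1) _ Hf
  obtain ⟨e, e', he, hee⟩ := pick_inj (d + d + 1) _ Hg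
  let G0 : Set k := Set.range c ∪ Set.range c' ∪ (Set.range e ∪ Set.range e')
  have hG0 : G0.Finite := ((Set.finite_range c).union (Set.finite_range c')).union ((Set.finite_range e).union (Set.finite_range e'))
  let A0 : Subalgebra ℂ k := Algebra.adjoin ℂ G0
  let ι : k →ₐ[ℂ] L := IsScalarTower.toAlgHom ℂ k L
  let G : Set L := (ι '' G0) ∪ (Set.range σ ∪ (Set.range p0 ∪ Set.range p1) ∪ {(wdg p0 p1)⁻¹, (aeval σ w)⁻¹})
  have hG : G.Finite := (hG0.image ι).union (((Set.finite_range σ).union ((Set.finite_range p0).union (Set.finite_range p1))).union (Set.toFinite _))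
  let A : Subalgebra ℂ L := Algebra.adjoin ℂ G
  have hA0ft : Algebra.FiniteType ℂ A0 := (Subalgebra.fg_iff_finiteType A0).mp ⟨hG0.toFinset, by simp [A0]⟩
  have hAft : Algebra.FiniteType ℂ A := (Subalgebra.fg_iff_finiteType A).mp ⟨hG.toFinset, by simp [A]⟩
  have hnoeth : IsNoetherianRing A0 := Algebra.FiniteType.isNoetherianRing ℂ A0
  have hle : A0.map ι ≤ A := by
    rw [AlgHom.map_adjoin]
    exact Algebra.adjoin_mono Set.subset_union_left
  have hm0 : ∀ x ∈ G0, x ∈ A0 := fun x hx => Algebra.subset_adjoin hx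
  have hmA : ∀ x ∈ G, x ∈ A := fun x hx => Algebra.subset_adjoin hx
  let j : A0 →ₐ[ℂ] A := (ι.comp A0.val).codRestrict A (fun x => hle ⟨x, x.2, rfl⟩)
  have hjv : ∀ x : A0, (j x : L) = algebraMap k L x := fun x => rfl
  let C : Fin (d + d + 1) → A0 := fun i => ⟨c i, hm0 _ (by simp [G0])⟩
  let C' : Fin (d + d + 1) → A0 := fun i => ⟨c' i, hm0 _ (by simp [G0])⟩
  let E : Fin (d + d + 1) → A0 := fun i => ⟨e i, hm0 _ (by simp [G0])⟩
  let E' : Fin (d + d + 1) → A0 := fun i => ⟨e' i, hm0 _ (by simp [G0])⟩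
  let σA : Fin N → A := fun i => ⟨σ i, hmA _ (by simp [G])⟩
  let q0 : Fin 2 → A := fun i => ⟨p0 i, hmA _ (by simp [G])⟩
  let q1 : Fin 2 → A := fun i => ⟨p1 i, hmA _ (by simp [G])⟩
  let Di : A := ⟨(wdg p0 p1)⁻¹, hmA _ (by simp [G])⟩
  let wi : A := ⟨(aeval σ w)⁻¹, hmA _ (by simp [G])⟩
  have hval : ∀ p : MvPolynomial (Fin N) ℂ, ((aeval σA p : A) : L) = aeval σ p := by
    intro p
    have : A.val (aeval σA p) = aeval (fun i => A.val (σA i)) p := by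
      rw [← AlgHom.comp_apply, comp_aeval]
    exact this
  have hqD : wdg q0 q1 * Di = 1 := by
    apply Subtype.ext
    have : ((wdg q0 q1 : A) : L) = wdg p0 p1 := (wdg_map A.val.toRingHom q0 q1).symm
    simp only [MulMemClass.coe_mul, this, Di, OneMemClass.coe_one]
    exact mul_inv_cancel₀ hD
  have hqw : aeval σA w * wi = 1 := by
    apply Subtype.ext
    simp only [MulMemClass.coe_mul, hval, wi, OneMemClass.coe_one]
    exact mul_inv_cancel₀ hw
  have hrel : ∀ (a b : Fin (d + 1) → MvPolynomial (Fin N) ℂ) (x y : A0),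
      wdg (GG (cf a σ) (cf b σ) (algebraMap k L x • p0 + p1)) (algebraMap k L y • p0 + p1) = 0 →
      wdg (GG (cf a σA) (cf b σA) (j x • q0 + q1)) (j y • q0 + q1) = 0 := by
    intro a b x y h
    apply Subtype.val_injective
    have h1 := rel_map A.val.toRingHom (cf a σA) (cf b σA) q0 q1 (j x) (j y)
    have ha : (fun i => A.val.toRingHom (cf a σA i)) = cf a σ := cf_map a σA A.val
    have hb : (fun i => A.val.toRingHom (cf b σA i)) = cf b σ := cf_map b σA A.val
    rw [ha, hb] at h1
    exact h1.trans h
  let φ : Polynomial A0 →ₐ[ℂ] A := Polynomial.eval₂AlgHom j (σA i0) (fun _ => Commute.all _ _)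
  have hφ : Function.Injective φ := by
    rw [injective_iff_map_eq_zero]
    intro P hP
    have h1 : (φ P : L) = Polynomial.aeval (σ i0) (P.map (algebraMap A0 k)) := by
      have e1 : φ P = P.eval₂ (j : A0 →+* A) (σA i0) := rfl
      have e2 : ((P.eval₂ (j : A0 →+* A) (σA i0) : A) : L) = A.val.toRingHom (P.eval₂ (j : A0 →+* A) (σA i0)) := rfl
      rw [e1, e2, Polynomial.hom_eval₂, Polynomial.aeval_def, Polynomial.eval₂_map]
      rfl
    rw [hP] at h1
    have h2 := (transcendental_iff.mp htr) _ h1.symm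
    exact (Polynomial.map_eq_zero_iff (FaithfulSMul.algebraMap_injective A0 k)).mp h2
  obtain ⟨b, hb0, hb⟩ := chev φ hφ
  obtain ⟨δ1, hδ1, hδ1'⟩ := diff_prod C (fun i j h => hc (congrArg Subtype.val h))
  obtain ⟨δ2, hδ2, hδ2'⟩ := diff_prod E (fun i j h => he (congrArg Subtype.val h))
  obtain ⟨χ, hχ⟩ := nullst_ne (k := ℂ) (b.leadingCoeff * (δ1 * δ2)) (mul_ne_zero (Polynomial.leadingCoeff_ne_zero.mpr hb0) (mul_ne_zero hδ1 hδ2))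
  rw [map_mul, map_mul] at hχ
  have hχb := left_ne_zero_of_mul hχ
  have hχC := hδ1' χ.toRingHom (left_ne_zero_of_mul (right_ne_zero_of_mul hχ))
  have hχE := hδ2' χ.toRingHom (right_ne_zero_of_mul (right_ne_zero_of_mul hχ))
  have hbχ : b.map χ.toRingHom ≠ 0 := by
    intro h
    have := congrArg (fun p => Polynomial.coeff p b.natDegree) h
    simp only [Polynomial.coeff_map, Polynomial.coeff_zero] at this
    exact hχb this
  let T : Set ℂ := {τ | (b.map χ.toRingHom).eval τ ≠ 0}
  have hT : T.Infinite := by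
    have h1 : {τ | (b.map χ.toRingHom).eval τ = 0}.Finite := by
      refine (b.map χ.toRingHom).rootSet_finite ℂ |>.subset ?_
      intro τ hτ
      rw [Polynomial.mem_rootSet]
      exact ⟨hbχ, by simpa using hτ⟩
    exact h1.infinite_compl
  have hψ : ∀ τ ∈ T, ∃ ψ : A →ₐ[ℂ] ℂ, ψ (σA i0) = τ ∧ ∀ x, ψ (j x) = χ x := by
    intro τ hτ
    obtain ⟨ψ, hψ⟩ := hb (Polynomial.eval₂AlgHom χ τ (fun _ => Commute.all _ _)) (by
      have e1 : (Polynomial.eval₂AlgHom χ τ (fun _ => Commute.all _ _)) b = b.eval₂ χ.toRingHom τ := rfl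
      rw [e1, ← Polynomial.eval_map]
      exact hτ)
    refine ⟨ψ, ?_, ?_⟩
    · have := DFunLike.congr_fun hψ Polynomial.X
      simpa [φ] using this
    · intro x
      have := DFunLike.congr_fun hψ (Polynomial.C x)
      simpa [φ] using this
  have hne : Nonempty (A →ₐ[ℂ] ℂ) := nullst
  choose! ψ hψ1 hψ2 using hψ
  let s : ℂ → Fin N → ℂ := fun τ i => ψ τ (σA i)
  have hev : ∀ τ (p : MvPolynomial (Fin N) ℂ), aeval (s τ) p = ψ τ (aeval σA p) := by
    intro τ p
    rw [← AlgHom.comp_apply, comp_aeval]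
  have hsS : ∀ τ, s τ ∈ S := by
    intro τ
    apply hS
    · intro p hp
      rw [hev]
      have : aeval σA p = 0 := Subtype.ext (by rw [hval, hJ p hp]; rfl)
      rw [this, map_zero]
    · rw [hev]
      have := congrArg (ψ τ) hqw
      rw [map_mul, map_one] at this
      exact left_ne_zero_of_mul_eq_one this
  have hDs : ∀ τ, wdg (fun i => ψ τ (q0 i)) (fun i => ψ τ (q1 i)) ≠ 0 := by
    intro τ
    have h1 : wdg (fun i => ψ τ (q0 i)) (fun i => ψ τ (q1 i)) = ψ τ (wdg q0 q1) := wdg_map (ψ τ).toRingHom q0 q1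
    rw [h1]
    have := congrArg (ψ τ) hqD
    rw [map_mul, map_one] at this
    exact left_ne_zero_of_mul_eq_one this
  have hrs : ∀ τ ∈ T, ∀ (a b : Fin (d + 1) → MvPolynomial (Fin N) ℂ) (x y : A0),
      wdg (GG (cf a σ) (cf b σ) (algebraMap k L x • p0 + p1)) (algebraMap k L y • p0 + p1) = 0 →
      wdg (GG (cf a (s τ)) (cf b (s τ)) (χ x • (fun i => ψ τ (q0 i)) + (fun i => ψ τ (q1 i))))
        (χ y • (fun i => ψ τ (q0 i)) + (fun i => ψ τ (q1 i))) = 0 := by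
    intro τ hτ a b x y h
    have h1 := rel_map (ψ τ).toRingHom (cf a σA) (cf b σA) q0 q1 (j x) (j y)
    rw [hrel a b x y h, map_zero] at h1
    have ha : (fun i => (ψ τ).toRingHom (cf a σA i)) = cf a (s τ) := cf_map a σA (ψ τ)
    have hb : (fun i => (ψ τ).toRingHom (cf b σA i)) = cf b (s τ) := cf_map b σA (ψ τ)
    rw [ha, hb] at h1
    have e1 := hψ2 τ hτ x
    have e2 := hψ2 τ hτ y
    rw [← e1, ← e2]
    exact h1.symm
  obtain ⟨τ0, hτ0⟩ := hT.nonempty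
  have hfin := hmax (s τ0) (hsS τ0)
  have hinf : (s '' T).Infinite := hT.image (by
    intro τ hτ τ' hτ' h
    have := congrFun h i0
    simp only [s] at this
    rwa [hψ1 τ hτ, hψ1 τ' hτ'] at this)
  refine hinf (hfin.subset ?_)
  rintro _ ⟨τ, hτ, rfl⟩
  refine ⟨hsS τ, linE _ _ _ _ (hDs τ0) (hDs τ), ?_, ?_⟩
  · intro v
    exact conj_lemma _ _ _ _ _ _ _ _ (hDs τ0) (hDs τ) (fun i => χ (C i)) (fun i => χ (C' i)) hχC
      (fun i => hrs τ0 hτ0 fa fb (C i) (C' i) (hcc i)) (fun i => hrs τ hτ fa fb (C i) (C' i) (hcc i)) v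
  · intro v
    exact conj_lemma _ _ _ _ _ _ _ _ (hDs τ0) (hDs τ) (fun i => χ (E i)) (fun i => χ (E' i)) hχE
      (fun i => hrs τ0 hτ0 ga gb (E i) (E' i) (hee i)) (fun i => hrs τ hτ ga gb (E i) (E' i) (hee i)) v

theorem good_gen {F : Type*} [Field F] [Algebra ℂ F] {N d : ℕ} (a b : Fin (d + 1) → MvPolynomial (Fin N) ℂ)
    (S : Set (Fin N → ℂ)) (J : Set (MvPolynomial (Fin N) ℂ)) (w : MvPolynomial (Fin N) ℂ)
    (hS : ∀ s : Fin N → ℂ, (∀ p ∈ J, aeval s p = 0) → aeval s w ≠ 0 → s ∈ S)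
    (hgood : ∀ s ∈ S, GoodV (cf a s) (cf b s))
    (σ : Fin N → F) (hJ : ∀ p ∈ J, aeval σ p = 0) (hw : aeval σ w ≠ 0) : GoodV (cf a σ) (cf b σ) := by
  intro v hv hz
  obtain ⟨i, hi⟩ := Function.ne_iff.mp hv
  let G : Set F := Set.range σ ∪ Set.range v ∪ {(v i)⁻¹, (aeval σ w)⁻¹}
  have hG : G.Finite := ((Set.finite_range σ).union (Set.finite_range v)).union (Set.toFinite _)
  let A : Subalgebra ℂ F := Algebra.adjoin ℂ G
  have hAft : Algebra.FiniteType ℂ A := (Subalgebra.fg_iff_finiteType A).mp ⟨hG.toFinset, by simp [A]⟩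
  have hmA : ∀ x ∈ G, x ∈ A := fun x hx => Algebra.subset_adjoin hx
  let σA : Fin N → A := fun i => ⟨σ i, hmA _ (by simp [G])⟩
  let vA : Fin 2 → A := fun i => ⟨v i, hmA _ (by simp [G])⟩
  let vi : A := ⟨(v i)⁻¹, hmA _ (by simp [G])⟩
  let wi : A := ⟨(aeval σ w)⁻¹, hmA _ (by simp [G])⟩
  have hval : ∀ p : MvPolynomial (Fin N) ℂ, ((aeval σA p : A) : F) = aeval σ p := by
    intro p
    have : A.val (aeval σA p) = aeval (fun i => A.val (σA i)) p := by
      rw [← AlgHom.comp_apply, comp_aeval]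
    exact this
  have hqw : aeval σA w * wi = 1 := by
    apply Subtype.ext
    simp only [MulMemClass.coe_mul, hval, wi, OneMemClass.coe_one]
    exact mul_inv_cancel₀ hw
  have hqv : vA i * vi = 1 := by
    apply Subtype.ext
    simp only [MulMemClass.coe_mul, vA, vi, OneMemClass.coe_one]
    exact mul_inv_cancel₀ hi
  obtain ⟨χ⟩ := nullst (k := ℂ) (R := A)
  have hev : ∀ (p : MvPolynomial (Fin N) ℂ), aeval (fun i => χ (σA i)) p = χ (aeval σA p) := by
    intro p
    rw [← AlgHom.comp_apply, comp_aeval]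
  have hsS : (fun i => χ (σA i)) ∈ S := by
    apply hS
    · intro p hp
      rw [hev]
      have : aeval σA p = 0 := Subtype.ext (by rw [hval, hJ p hp]; rfl)
      rw [this, map_zero]
    · rw [hev]
      have := congrArg χ hqw
      rw [map_mul, map_one] at this
      exact left_ne_zero_of_mul_eq_one this
  refine hgood _ hsS (fun i => χ (vA i)) ?_ ?_
  · have := congrArg χ hqv
    rw [map_mul, map_one] at this
    exact fun h => left_ne_zero_of_mul_eq_one this (congrFun h i)
  · have h0 : GG (cf a σA) (cf b σA) vA = 0 := by
      have h1 := GG_map (cf a σA) (cf b σA) A.val.toRingHom vA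
      have ha : (fun i => A.val.toRingHom (cf a σA i)) = cf a σ := cf_map a σA A.val
      have hb : (fun i => A.val.toRingHom (cf b σA i)) = cf b σ := cf_map b σA A.val
      rw [ha, hb] at h1
      ext i
      have := congrFun (h1.symm.trans hz) i
      exact this
    have h1 := GG_map (cf a σA) (cf b σA) χ.toRingHom vA
    have ha : (fun i => χ.toRingHom (cf a σA i)) = cf a (fun i => χ (σA i)) := cf_map a σA χ
    have hb : (fun i => χ.toRingHom (cf b σA i)) = cf b (fun i => χ (σA i)) := cf_map b σA χ
    rw [ha, hb, h0] at h1
    refine h1.trans ?_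
    ext i
    simp

theorem form_root {L : Type*} [Field L] [IsAlgClosed L] {d : ℕ} (hd : 1 ≤ d) (a : Fin (d + 1) → L) :
    ∃ v : Fin 2 → L, v ≠ 0 ∧ hev a v = 0 := by
  by_cases h : (pol a).coeff d = 0
  · refine ⟨![1, 0], ?_, by rw [← pol_coeff, h]⟩
    intro h
    simpa using congrFun h 0
  · have hdeg : (pol a).degree ≠ 0 := by
      have h1 : d ≤ (pol a).natDegree := Polynomial.le_natDegree_of_ne_zero h
      intro h2
      have : (pol a).natDegree = 0 := Polynomial.natDegree_eq_of_degree_eq_some h2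
      omega
    obtain ⟨z, hz⟩ := IsAlgClosed.exists_root _ hdeg
    exact ⟨![z, 1], vec_one_ne, by rw [← pol_eval]; exact hz⟩

theorem fib_finite {L : Type*} [Field L] [IsAlgClosed L] {d : ℕ} (hd : 1 ≤ d)
    (a b : Fin (d + 1) → L) (hg : GoodV a b) (q : Fin 2 → L) (hq : q ≠ 0) :
    {z : L | wdg (GG a b ![z, 1]) q = 0}.Finite := by
  have hform : ∀ (q : Fin 2 → L) v, hev (fun j => a j * q 1 - b j * q 0) v = wdg (GG a b v) q := by
    intro q v
    simp only [hev, wdg, GG, Matrix.cons_val_zero, Matrix.cons_val_one, Finset.sum_mul, ← Finset.sum_sub_distrib]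
    refine Finset.sum_congr rfl fun j _ => ?_
    ring
  let c := (fun j => a j * q 1 - b j * q 0)
  by_cases h : pol c = 0
  · exfalso
    have hc0 : c = 0 := by
      funext j
      have : (pol c).coeff j = 0 := by rw [h]; simp
      have h2 : (pol c).coeff j = c j := by
        simp only [pol]
        simp [Polynomial.coeff_X_pow, ← Fin.ext_iff]
      rw [← h2, this]; rfl
    obtain ⟨r, hr⟩ := exists_compl q hq
    obtain ⟨v, hv, hv0⟩ := form_root hd (fun j => a j * r 1 - b j * r 0)
    rw [hform] at hv0
    have h1 : wdg (GG a b v) q = 0 := by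
      rw [← hform]; change hev c v = 0; rw [hc0]; simp [hev]
    refine hg v hv ?_
    simp only [wdg] at h1 hv0 hr
    ext i
    fin_cases i
    · simp only [Fin.zero_eta, Pi.zero_apply]
      linear_combination (-(GG a b v 0)) * hr + q 0 * hv0 - r 0 * h1
    · simp only [Fin.mk_one, Pi.zero_apply]
      linear_combination (-(GG a b v 1)) * hr + q 1 * hv0 - r 1 * h1
  · refine (Polynomial.rootSet_finite (pol c) L).subset ?_
    intro z hz
    rw [Polynomial.mem_rootSet]
    refine ⟨h, ?_⟩
    rw [Polynomial.coe_aeval_eq_eval, pol_eval, hform]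
    exact hz

theorem trdeg_one {k L : Type} [Field k] [Field L] [Algebra ℂ k] [Algebra ℂ L] [Algebra k L] [IsScalarTower ℂ k L]
    (y0 : L) (t : Set L) (h3 : Algebra.IsAlgebraic (Algebra.adjoin ℂ t) L)
    (ht : ∀ z ∈ t, z = y0 ∨ z ∈ Set.range (algebraMap k L)) (htrk : Transcendental k y0)
    (x : Option (Fin 1) → L) (hx : AlgebraicIndependent k x) : False := by
  have h1 : AlgebraicIndependent k (fun _ : Fin 1 => y0) := algebraicIndependent_unique_type_iff.mpr htrk
  have h2 : IsTranscendenceBasis k (fun _ : Fin 1 => y0) := by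
    rw [h1.isTranscendenceBasis_iff_isAlgebraic]
    let B := Algebra.adjoin k (Set.range (fun _ : Fin 1 => y0))
    have hle : Algebra.adjoin ℂ t ≤ B.restrictScalars ℂ := by
      rw [Algebra.adjoin_le_iff]
      intro z hz
      rcases ht z hz with rfl | ⟨c, rfl⟩
      · exact Algebra.subset_adjoin (R := k) ⟨0, rfl⟩
      · exact B.algebraMap_mem c
    let φ : Algebra.adjoin ℂ t →+* B := (Subalgebra.inclusion hle).toRingHom
    refine ⟨fun z => ?_⟩
    obtain ⟨p, hp, hpz⟩ := h3.isAlgebraic z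
    have hφ : Function.Injective φ := Subalgebra.inclusion_injective hle
    refine ⟨p.map φ, (Polynomial.map_ne_zero_iff hφ).mpr hp, ?_⟩
    have hc : (algebraMap B L).comp φ = algebraMap (Algebra.adjoin ℂ t) L := rfl
    rw [Polynomial.aeval_def, Polynomial.eval₂_map, hc]
    exact hpz
  have h4 := h2.lift_cardinalMk_eq_trdeg
  have h5 := hx.lift_cardinalMk_le_trdeg
  rw [← h4] at h5
  simp at h5

theorem exists_k {L : Type} [Field L] [Algebra ℂ L] [IsAlgClosed L] {l : ℕ} (y : Fin (l + 1) → L)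
    (hy : AlgebraicIndependent ℂ y) :
    ∃ (k : Type) (_ : Field k) (_ : Algebra ℂ k) (_ : Algebra k L) (_ : IsScalarTower ℂ k L),
      IsAlgClosed k ∧ (∀ j : Fin l, y j.succ ∈ Set.range (algebraMap k L)) ∧ Transcendental k (y 0) ∧
      ∀ x : Option (Fin 1) → L, ¬ AlgebraicIndependent k x := by
  obtain ⟨t, hyt, ht⟩ := exists_isTranscendenceBasis_superset (R := ℂ) (s := Set.range y) hy.coe_range
  let T : Set L := t \ {y 0}
  let F := IntermediateField.adjoin ℂ T
  let k := algebraicClosure F L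
  have htow : IsScalarTower ℂ k L := IsScalarTower.of_algebraMap_eq (fun _ => rfl)
  have hins : insert (y 0) T = t := by
    simp only [T, Set.insert_sdiff_singleton]
    exact Set.insert_eq_of_mem (hyt ⟨0, rfl⟩)
  have hindep : AlgebraicIndepOn ℂ id (insert (y 0) T) := by
    rw [hins]; exact ht.1
  have htr0 := ((AlgebraicIndepOn.insert_iff (by simp [T])).mp hindep).2
  rw [Set.image_id] at htr0
  have htrF : Transcendental F (y 0) := by
    have h1 : AlgebraicIndependent (Algebra.adjoin ℂ T) (fun _ : Fin 1 => y 0) :=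
      algebraicIndependent_unique_type_iff.mpr htr0
    exact algebraicIndependent_unique_type_iff.mp (IntermediateField.algebraicIndependent_adjoin_iff.mpr h1)
  have htrk : Transcendental k (y 0) := htrF.algebraicClosure
  have hTk : ∀ z ∈ T, z ∈ k := by
    intro z hz
    rw [mem_algebraicClosure_iff]
    exact isAlgebraic_algebraMap (⟨z, IntermediateField.subset_adjoin ℂ T hz⟩ : F)
  refine ⟨k, inferInstance, inferInstance, inferInstance, inferInstance, IsAlgClosure.isAlgClosed F, ?_, htrk, ?_⟩
  · intro j
    refine ⟨⟨y j.succ, hTk _ ⟨hyt ⟨_, rfl⟩, ?_⟩⟩, rfl⟩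
    intro h
    exact Fin.succ_ne_zero j (hy.injective h)
  · intro x hx
    have h3 := ht.isAlgebraic
    rw [Subtype.range_coe] at h3
    refine trdeg_one (k := k) (y 0) t h3 ?_ htrk x hx
    intro z hz
    by_cases hz0 : z = y 0
    · exact Or.inl hz0
    · exact Or.inr ⟨⟨z, hTk z ⟨hz, hz0⟩⟩, rfl⟩

theorem step_const {k L R : Type} [Field k] [Field L] [CommRing R] [Algebra ℂ k] [Algebra ℂ L] [Algebra k L]
    [IsScalarTower ℂ k L] [IsAlgClosed k] [Algebra ℂ R] [Algebra.FiniteType ℂ R]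
    (h2 : ∀ x : Option (Fin 1) → L, ¬ AlgebraicIndependent k x)
    (ι : R →ₐ[ℂ] L) {N d : ℕ} (fa fb ga gb : Fin (d + 1) → MvPolynomial (Fin N) ℂ)
    (w : MvPolynomial (Fin N) ℂ) (σ : Fin N → R) (π : Polynomial R) (z : L) (p0 p1 : Fin 2 → L)
    (hD : wdg p0 p1 ≠ 0)
    (H0 : PreV (cf ga (fun i => ι (σ i))) (cf gb (fun i => ι (σ i))) p0)
    (H1 : PreV (cf ga (fun i => ι (σ i))) (cf gb (fun i => ι (σ i))) p1)
    (H01 : PreV (cf ga (fun i => ι (σ i))) (cf gb (fun i => ι (σ i))) (p0 + p1))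
    (Hf : PreV (cf fa (fun i => ι (σ i))) (cf fb (fun i => ι (σ i))) ![z, 1])
    (hw : ι (aeval σ w) ≠ 0) (hπ : π.eval₂ ι.toRingHom z ≠ 0)
    (hno : ∀ (θ : R →ₐ[ℂ] k) (x : k), (∀ (r : R) (c : k), ι r = algebraMap k L c → θ r = c) →
      θ (aeval σ w) ≠ 0 → PreV (cf fa (fun i => θ (σ i))) (cf fb (fun i => θ (σ i))) ![x, 1] →
      PreV (cf ga (fun i => θ (σ i))) (cf gb (fun i => θ (σ i))) ![x, 1] → π.eval₂ θ.toRingHom x ≠ 0 → False) :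
    (∃ c : k, wdg ![z, 1] (algebraMap k L c • p0 + p1) = 0) ∧
    {c : k | ∃ c' : k, wdg (GG (cf ga (fun i => ι (σ i))) (cf gb (fun i => ι (σ i))) (algebraMap k L c • p0 + p1))
      (algebraMap k L c' • p0 + p1) = 0}.Infinite := by
  have : CharZero k := charZero_of_injective_algebraMap (algebraMap ℂ k).injective
  obtain ⟨T, hT⟩ := (inferInstance : Algebra.FiniteType ℂ R)
  let G : Set L := (ι '' T) ∪ (Set.range p0 ∪ Set.range p1) ∪ {z, (wdg p0 p1)⁻¹, (ι (aeval σ w))⁻¹, (π.eval₂ ι.toRingHom z)⁻¹}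
  have hG : G.Finite := ((T.finite_toSet.image ι).union ((Set.finite_range p0).union (Set.finite_range p1))).union (Set.toFinite _)
  let A : Subalgebra k L := Algebra.adjoin k G
  have hAfg : A.FG := ⟨hG.toFinset, by simp [A]⟩
  have hmA : ∀ x ∈ G, x ∈ A := fun x hx => Algebra.subset_adjoin hx
  have hιA : ∀ r, ι r ∈ A := by
    intro r
    have h1 : (⊤ : Subalgebra ℂ R).map ι ≤ A.restrictScalars ℂ := by
      rw [← hT, AlgHom.map_adjoin, Algebra.adjoin_le_iff]
      intro x hx
      exact hmA x (Or.inl (Or.inl hx))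
    exact h1 ⟨r, trivial, rfl⟩
  let j : R →ₐ[ℂ] A := { (ι.toRingHom.codRestrict A hιA) with
    commutes' := fun c => Subtype.ext (by
      change ι (algebraMap ℂ R c) = algebraMap ℂ L c
      exact ι.commutes c) }
  have hj : ∀ r, (j r : L) = ι r := fun r => rfl
  let q0 : Fin 2 → A := fun i => ⟨p0 i, hmA _ (by simp [G])⟩
  let q1 : Fin 2 → A := fun i => ⟨p1 i, hmA _ (by simp [G])⟩
  let zA : A := ⟨z, hmA _ (by simp [G])⟩
  let Di : A := ⟨(wdg p0 p1)⁻¹, hmA _ (by simp [G])⟩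
  let wi : A := ⟨(ι (aeval σ w))⁻¹, hmA _ (by simp [G])⟩
  let πi : A := ⟨(π.eval₂ ι.toRingHom z)⁻¹, hmA _ (by simp [G])⟩
  have hqD : wdg q0 q1 * Di = 1 := by
    apply Subtype.ext
    have : ((wdg q0 q1 : A) : L) = wdg p0 p1 := (wdg_map A.val.toRingHom q0 q1).symm
    simp only [MulMemClass.coe_mul, this, Di, OneMemClass.coe_one]
    exact mul_inv_cancel₀ hD
  have hqw : j (aeval σ w) * wi = 1 := by
    apply Subtype.ext
    simp only [MulMemClass.coe_mul, hj, wi, OneMemClass.coe_one]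
    exact mul_inv_cancel₀ hw
  have hqπ : π.eval₂ j.toRingHom zA * πi = 1 := by
    apply Subtype.ext
    have : ((π.eval₂ j.toRingHom zA : A) : L) = π.eval₂ ι.toRingHom z := by
      have : A.val.toRingHom (π.eval₂ j.toRingHom zA) = _ := Polynomial.hom_eval₂ _ _ _ _
      exact this
    simp only [MulMemClass.coe_mul, this, πi, OneMemClass.coe_one]
    exact mul_inv_cancel₀ hπ
  let sA : Fin N → A := fun i => j (σ i)
  have hcf : ∀ (a : Fin (d + 1) → MvPolynomial (Fin N) ℂ), (fun i => A.val.toRingHom (cf a sA i)) = cf a (fun i => ι (σ i)) :=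
    fun a => cf_map a sA (A.val.restrictScalars ℂ)
  have hinj : Function.Injective A.val.toRingHom := Subtype.val_injective
  have hpre : ∀ (a b : Fin (d + 1) → MvPolynomial (Fin N) ℂ) (v : Fin 2 → A),
      PreV (cf a (fun i => ι (σ i))) (cf b (fun i => ι (σ i))) (fun i => A.val.toRingHom (v i)) → PreV (cf a sA) (cf b sA) v := by
    intro a b v h
    apply PreV_of_map _ _ A.val.toRingHom hinj
    rw [hcf, hcf]
    exact h
  have hres := main_const h2 A hAfg (cf ga sA) (cf gb sA) q0 q1 ![zA, 1] (IsUnit.of_mul_eq_one _ hqD)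
    (hpre _ _ _ H0) (hpre _ _ _ H1) (hpre _ _ _ H01) ?_
  · have e1 : (fun i => ((![zA, 1] : Fin 2 → A) i : L)) = ![z, 1] := by
      ext i; fin_cases i <;> rfl
    rw [e1] at hres
    refine ⟨hres.1, ?_⟩
    have h3 := hres.2
    have ha : (fun i => ((cf ga sA i : A) : L)) = cf ga (fun i => ι (σ i)) := hcf ga
    have hb : (fun i => ((cf gb sA i : A) : L)) = cf gb (fun i => ι (σ i)) := hcf gb
    rw [ha, hb] at h3
    exact h3
  · intro χ hχ
    let θ : R →ₐ[ℂ] k := (χ.restrictScalars ℂ).comp j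
    have hcfθ : ∀ (a : Fin (d + 1) → MvPolynomial (Fin N) ℂ), (fun i => χ (cf a sA i)) = cf a (fun i => θ (σ i)) :=
      fun a => cf_map a sA (χ.restrictScalars ℂ)
    have hv : ∀ x : A, (fun i => χ ((![x, 1] : Fin 2 → A) i)) = ![χ x, 1] := by
      intro x; ext i; fin_cases i <;> simp
    refine hno θ (χ zA) ?_ ?_ ?_ ?_ ?_
    · intro r c h
      have : j r = algebraMap k A c := Subtype.ext h
      change χ (j r) = c
      rw [this, AlgHom.commutes]; rfl
    · have := congrArg χ hqw
      rw [map_mul, map_one] at this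
      exact left_ne_zero_of_mul_eq_one this
    · have h := PreV_map (cf fa sA) (cf fb sA) χ.toRingHom ![zA, 1] (hpre _ _ _ (by
        convert Hf using 1
        ext i; fin_cases i <;> rfl))
      have ha : (fun i => χ.toRingHom (cf fa sA i)) = cf fa (fun i => θ (σ i)) := hcfθ fa
      have hb : (fun i => χ.toRingHom (cf fb sA i)) = cf fb (fun i => θ (σ i)) := hcfθ fb
      have hv' : (fun i => χ.toRingHom ((![zA, 1] : Fin 2 → A) i)) = ![χ zA, 1] := hv zA
      rw [ha, hb, hv'] at h
      exact h
    · rw [hcfθ, hcfθ, hv] at hχ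
      exact hχ
    · have := congrArg χ hqπ
      rw [map_mul, map_one] at this
      have e : χ (π.eval₂ j.toRingHom zA) = π.eval₂ θ.toRingHom (χ zA) := by
        have : χ.toRingHom (π.eval₂ j.toRingHom zA) = _ := Polynomial.hom_eval₂ _ _ _ _
        exact this
      rw [e] at this
      exact left_ne_zero_of_mul_eq_one this

/-- infinitely many good preperiodic points whose image is good too -/
theorem good_inf {L : Type} [Field L] [CharZero L] [IsAlgClosed L] {d : ℕ} (hd : 2 ≤ d)
    (a b : Fin (d + 1) → L) (hg : GoodV a b) (P : Polynomial L) (hP : P ≠ 0) :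
    {z : L | PreV a b ![z, 1] ∧ P.eval z ≠ 0 ∧ ∃ z' : L, PreV a b ![z', 1] ∧ P.eval z' ≠ 0 ∧
      wdg (GG a b ![z, 1]) ![z', 1] = 0}.Infinite := by
  have h1 := inf_thm hd a b hg
  have hroots : {z | P.eval z = 0}.Finite := by
    refine (P.rootSet_finite L).subset ?_
    intro z hz
    rw [Polynomial.mem_rootSet]
    exact ⟨hP, by simpa using hz⟩
  have hb1 := fib_finite (by omega) a b hg ![1, 0] (by intro h; simpa using congrFun h 0)
  have hb2 : (⋃ r ∈ {z | P.eval z = 0}, {z : L | wdg (GG a b ![z, 1]) ![r, 1] = 0}).Finite :=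
    hroots.biUnion fun r _ => fib_finite (by omega) a b hg _ vec_one_ne
  refine ((h1.sdiff ((hroots.union hb1).union hb2))).mono ?_
  rintro z ⟨hz, hn⟩
  simp only [Set.mem_union, Set.mem_iUnion, not_or, not_exists, Set.mem_ofPred_eq] at hn
  obtain ⟨⟨hn1, hn2⟩, hn3⟩ := hn
  refine ⟨hz, hn1, ?_⟩
  have hb0 : hev b ![z, 1] ≠ 0 := by
    intro h
    apply hn2
    simp [wdg, GG, h]
  have hG := GG_eq_smul a b ![z, 1] (hev a ![z, 1] / hev b ![z, 1]) (by field_simp)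
  have hw : wdg (GG a b ![z, 1]) ![hev a ![z, 1] / hev b ![z, 1], 1] = 0 := by
    rw [hG, wdg_smul_left, wdg_self, mul_zero]
  refine ⟨hev a ![z, 1] / hev b ![z, 1], ?_, ?_, hw⟩
  · exact PreV_wdg a b (hg _ vec_one_ne) hw (PreV_GG a b (by omega) hz)
  · intro h
    exact hn3 _ h hw

theorem three_pts {L : Type} [Field L] [CharZero L] [IsAlgClosed L] {d : ℕ} (hd : 2 ≤ d)
    (a b : Fin (d + 1) → L) (hg : GoodV a b) :
    ∃ p0 p1 : Fin 2 → L, wdg p0 p1 ≠ 0 ∧ PreV a b p0 ∧ PreV a b p1 ∧ PreV a b (p0 + p1) := by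
  have h1 := inf_thm hd a b hg
  let e := h1.natEmbedding
  have hne : ∀ i j : ℕ, i ≠ j → (e i : L) - e j ≠ 0 := by
    intro i j hij h
    exact hij (e.injective (Subtype.ext (sub_eq_zero.mp h)))
  refine ⟨((e 3 : L) - e 2) • ![(e 1 : L), 1], ((e 1 : L) - e 3) • ![(e 2 : L), 1], ?_, ?_, ?_, ?_⟩
  · have : wdg (((e 3 : L) - e 2) • ![(e 1 : L), 1]) (((e 1 : L) - e 3) • ![(e 2 : L), 1]) =
      ((e 3 : L) - e 2) * (((e 1 : L) - e 3) * ((e 1 : L) - e 2)) := by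
      simp [wdg]; ring
    rw [this]
    exact mul_ne_zero (hne _ _ (by norm_num)) (mul_ne_zero (hne _ _ (by norm_num)) (hne _ _ (by norm_num)))
  · exact PreV_smul a b _ _ (e 1).2
  · exact PreV_smul a b _ _ (e 2).2
  · have : ((e 3 : L) - e 2) • ![(e 1 : L), 1] + ((e 1 : L) - e 3) • ![(e 2 : L), 1] = ((e 1 : L) - e 2) • ![(e 3 : L), 1] := by
      ext i; fin_cases i <;> simp <;> ring
    rw [this]
    exact PreV_smul a b _ _ (e 3).2

theorem step_L {N d : ℕ} (hd : 2 ≤ d) (fa fb ga gb : Fin (d + 1) → MvPolynomial (Fin N) ℂ) (S : Set (Fin N → ℂ))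
    (J : Set (MvPolynomial (Fin N) ℂ)) (w : MvPolynomial (Fin N) ℂ)
    (hS : ∀ s : Fin N → ℂ, (∀ p ∈ J, aeval s p = 0) → aeval s w ≠ 0 → s ∈ S)
    (hf : ∀ s ∈ S, GoodV (cf fa s) (cf fb s)) (hg : ∀ s ∈ S, GoodV (cf ga s) (cf gb s))
    (hmax : ∀ s₀ ∈ S, Set.Finite {s | s ∈ S ∧ ∃ M : (Fin 2 → ℂ) ≃ₗ[ℂ] (Fin 2 → ℂ),
      ConjV (cf fa s₀) (cf fb s₀) (cf fa s) (cf fb s) M ∧ ConjV (cf ga s₀) (cf gb s₀) (cf ga s) (cf gb s) M})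
    {L R : Type} [Field L] [IsAlgClosed L] [Algebra ℂ L] [CommRing R] [IsDomain R] [Algebra ℂ R] [Algebra.FiniteType ℂ R]
    (ι : R →ₐ[ℂ] L) (hι : Function.Injective ι)
    (σ : Fin N → R) (hJ : ∀ p ∈ J, aeval σ p = 0) (hw : aeval σ w ≠ 0) {l : ℕ} (i : Fin (l + 1) → Fin N)
    (hi : AlgebraicIndependent ℂ (fun j => σ (i j))) (π : Polynomial R) (hπ : π ≠ 0) :
    ∃ (F : Type) (_ : Field F) (_ : Algebra ℂ F) (θ : R →ₐ[ℂ] F) (x : F), θ (aeval σ w) ≠ 0 ∧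
      AlgebraicIndependent ℂ (fun j : Fin l => θ (σ (i j.succ))) ∧
      PreV (cf fa (fun i => θ (σ i))) (cf fb (fun i => θ (σ i))) ![x, 1] ∧
      PreV (cf ga (fun i => θ (σ i))) (cf gb (fun i => θ (σ i))) ![x, 1] ∧ π.eval₂ θ.toRingHom x ≠ 0 := by
  by_contra hcon
  have hcon' : ∀ (F : Type) (_ : Field F) (_ : Algebra ℂ F) (θ : R →ₐ[ℂ] F) (x : F), θ (aeval σ w) ≠ 0 →
      AlgebraicIndependent ℂ (fun j : Fin l => θ (σ (i j.succ))) →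
      PreV (cf fa (fun i => θ (σ i))) (cf fb (fun i => θ (σ i))) ![x, 1] →
      PreV (cf ga (fun i => θ (σ i))) (cf gb (fun i => θ (σ i))) ![x, 1] → π.eval₂ θ.toRingHom x ≠ 0 → False :=
    fun F i1 i2 θ x h1 h2 h3 h4 h5 => hcon ⟨F, i1, i2, θ, x, h1, h2, h3, h4, h5⟩
  clear hcon
  have : CharZero L := charZero_of_injective_algebraMap (algebraMap ℂ L).injective
  let y : Fin (l + 1) → L := fun j => ι (σ (i j))
  have hy : AlgebraicIndependent ℂ y := hi.map' hι
  obtain ⟨k, _, _, _, _, _, hyk, htr, h2⟩ := exists_k y hy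
  let s : Fin N → L := fun i => ι (σ i)
  have hs : ∀ p : MvPolynomial (Fin N) ℂ, aeval s p = ι (aeval σ p) := by
    intro p
    rw [← AlgHom.comp_apply, comp_aeval]
  have hsJ : ∀ p ∈ J, aeval s p = 0 := fun p hp => by rw [hs, hJ p hp, map_zero]
  have hιw : ι (aeval σ w) ≠ 0 := fun h => hw (hι (by rw [h, map_zero]))
  have hsw : aeval s w ≠ 0 := by rw [hs]; exact hιw
  have hfs := good_gen fa fb S J w hS hf s hsJ hsw
  have hgs := good_gen ga gb S J w hS hg s hsJ hsw
  obtain ⟨p0, p1, hD, H0, H1, H01⟩ := three_pts hd _ _ hgs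
  have hno : ∀ (θ : R →ₐ[ℂ] k) (x : k), (∀ (r : R) (c : k), ι r = algebraMap k L c → θ r = c) →
      θ (aeval σ w) ≠ 0 → PreV (cf fa (fun i => θ (σ i))) (cf fb (fun i => θ (σ i))) ![x, 1] →
      PreV (cf ga (fun i => θ (σ i))) (cf gb (fun i => θ (σ i))) ![x, 1] → π.eval₂ θ.toRingHom x ≠ 0 → False := by
    intro θ x hθ h1 h3 h4 h5
    refine hcon' k _ _ θ x h1 ?_ h3 h4 h5
    refine AlgebraicIndependent.of_comp (IsScalarTower.toAlgHom ℂ k L) ?_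
    have hcomp : ((IsScalarTower.toAlgHom ℂ k L) ∘ fun j : Fin l => θ (σ (i j.succ))) = y ∘ Fin.succ := by
      funext j
      obtain ⟨c, hc⟩ := hyk j
      have := hθ (σ (i j.succ)) c hc.symm
      change algebraMap k L (θ (σ (i j.succ))) = y j.succ
      rw [this, hc]
    rw [hcomp]
    exact hy.comp _ (Fin.succ_injective l)
  have key : ∀ z : L, PreV (cf fa s) (cf fb s) ![z, 1] → (π.map ι.toRingHom).eval z ≠ 0 →
      (∃ c : k, wdg ![z, 1] (algebraMap k L c • p0 + p1) = 0) ∧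
      {c : k | ∃ c' : k, wdg (GG (cf ga s) (cf gb s) (algebraMap k L c • p0 + p1))
      (algebraMap k L c' • p0 + p1) = 0}.Infinite := by
    intro z hz hzπ
    exact step_const h2 ι fa fb ga gb w σ π z p0 p1 hD H0 H1 H01 hz hιw (by rwa [← Polynomial.eval_map]) hno
  have hπι : π.map ι.toRingHom ≠ 0 := (Polynomial.map_ne_zero_iff hι).mpr hπ
  have hinf := good_inf hd _ _ hfs _ hπι
  have hune : ∀ c : k, algebraMap k L c • p0 + p1 ≠ 0 := by
    intro c h
    apply hD
    have : wdg p0 (algebraMap k L c • p0 + p1) = wdg p0 p1 := by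
      rw [wdg_add_right, wdg_smul_right, wdg_self]; ring
    rw [← this, h]; simp [wdg]
  obtain ⟨z0, hz0⟩ := hinf.nonempty
  have Hg := (key z0 hz0.1 hz0.2.1).2
  refine iso_thm (k := k) fa fb ga gb S J w hS hmax s hsJ hsw (i 0) htr p0 p1 hD ?_ Hg
  have hc : ∀ z : {z : L | PreV (cf fa s) (cf fb s) ![z, 1] ∧ (π.map ι.toRingHom).eval z ≠ 0 ∧
      ∃ z' : L, PreV (cf fa s) (cf fb s) ![z', 1] ∧ (π.map ι.toRingHom).eval z' ≠ 0 ∧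
      wdg (GG (cf fa s) (cf fb s) ![z, 1]) ![z', 1] = 0}, ∃ c : k, wdg ![(z : L), 1] (algebraMap k L c • p0 + p1) = 0 :=
    fun z => (key z z.2.1 z.2.2.1).1
  choose c hc using hc
  have hcinj : Function.Injective c := by
    intro z z' h
    have h1 := hc z
    have h3 := hc z'
    rw [← h] at h3
    have h4 : wdg ![(z : L), 1] ![(z' : L), 1] = 0 := by
      refine wdg_trans (hune (c z)) h1 ?_
      rw [wdg_swap, h3, neg_zero]
    apply Subtype.ext
    simp [wdg] at h4
    exact sub_eq_zero.mp h4
  have : Infinite _ := hinf.to_subtype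
  refine (Set.infinite_range_of_injective hcinj).mono ?_
  rintro _ ⟨z, rfl⟩
  obtain ⟨z', hz', hz'π, hzz⟩ := z.2.2.2
  obtain ⟨c', hc'⟩ := (key z' hz' hz'π).1
  refine ⟨c', ?_⟩
  have h1 : wdg (algebraMap k L (c z) • p0 + p1) ![(z : L), 1] = 0 := by rw [wdg_swap, hc z, neg_zero]
  have h3 := GG_wdg (cf fa s) (cf fb s) (by omega) h1
  exact wdg_trans vec_one_ne (wdg_trans (hfs _ vec_one_ne) h3 hzz) hc'

theorem swap_poly {R : Type} [CommRing R] {l : ℕ} (Ψ : MvPolynomial (Fin (l + 1)) R) (hΨ : Ψ ≠ 0) :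
    ∃ Θ : MvPolynomial (Fin l) (Polynomial R), Θ ≠ 0 ∧ ∀ (F : Type) [CommRing F] (θ : R →+* F) (x : F) (z : Fin l → F),
      eval₂ (Polynomial.eval₂RingHom θ x) z Θ = eval₂ θ (Fin.cons x z) Ψ := by
  let e := (renameEquiv R (finSuccEquiv' (0 : Fin (l + 1)))).trans (optionEquivRight R (Fin l))
  refine ⟨e Ψ, (EmbeddingLike.map_ne_zero_iff).mpr hΨ, ?_⟩
  intro F _ θ x z
  have h : ((eval₂Hom (Polynomial.eval₂RingHom θ x) z).comp e.toRingEquiv.toRingHom) = eval₂Hom θ (Fin.cons x z) := by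
    apply MvPolynomial.ringHom_ext
    · intro r
      simp [e]
    · intro j
      refine Fin.cases ?_ (fun j => ?_) j
      · simp [e]
      · have h0 : finSuccEquiv' (0 : Fin (l + 1)) j.succ = some j := by simp
        simp [e, h0]
  exact DFunLike.congr_fun h Ψ

theorem Q_thm {N d : ℕ} (hd : 2 ≤ d) (fa fb ga gb : Fin (d + 1) → MvPolynomial (Fin N) ℂ) (S : Set (Fin N → ℂ))
    (J : Set (MvPolynomial (Fin N) ℂ)) (w : MvPolynomial (Fin N) ℂ)
    (hS : ∀ s : Fin N → ℂ, (∀ p ∈ J, aeval s p = 0) → aeval s w ≠ 0 → s ∈ S)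
    (hf : ∀ s ∈ S, GoodV (cf fa s) (cf fb s)) (hg : ∀ s ∈ S, GoodV (cf ga s) (cf gb s))
    (hmax : ∀ s₀ ∈ S, Set.Finite {s | s ∈ S ∧ ∃ M : (Fin 2 → ℂ) ≃ₗ[ℂ] (Fin 2 → ℂ),
      ConjV (cf fa s₀) (cf fb s₀) (cf fa s) (cf fb s) M ∧ ConjV (cf ga s₀) (cf gb s₀) (cf ga s) (cf gb s) M}) (l : ℕ) :
    ∀ {R : Type} [CommRing R] [IsDomain R] [Algebra ℂ R] [Algebra.FiniteType ℂ R]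
    (σ : Fin N → R) (_ : ∀ p ∈ J, aeval σ p = 0) (_ : aeval σ w ≠ 0) (i : Fin l → Fin N)
    (_ : AlgebraicIndependent ℂ (fun j => σ (i j))) (Ψ : MvPolynomial (Fin l) R) (_ : Ψ ≠ 0),
    ∃ χ : R →ₐ[ℂ] ℂ, χ (aeval σ w) ≠ 0 ∧ ∃ z : Fin l → ℂ,
      (∀ j, PreV (cf fa (fun i => χ (σ i))) (cf fb (fun i => χ (σ i))) ![z j, 1] ∧
        PreV (cf ga (fun i => χ (σ i))) (cf gb (fun i => χ (σ i))) ![z j, 1]) ∧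
      eval₂ χ.toRingHom z Ψ ≠ 0 := by
  induction l with
  | zero =>
    intro R _ _ _ _ σ hJ hw i hi Ψ hΨ
    rw [eq_C_of_isEmpty Ψ] at hΨ ⊢
    have hc : coeff 0 Ψ ≠ 0 := fun h => hΨ (by rw [h, C_0])
    obtain ⟨χ, hχ⟩ := nullst_ne (k := ℂ) (coeff 0 Ψ * aeval σ w) (mul_ne_zero hc hw)
    rw [map_mul] at hχ
    refine ⟨χ, right_ne_zero_of_mul hχ, fun j => j.elim0, fun j => j.elim0, ?_⟩
    rw [eval₂_C]
    exact left_ne_zero_of_mul hχ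
  | succ l ih =>
    intro R _ _ _ _ σ hJ hw i hi Ψ hΨ
    obtain ⟨Θ, hΘ, hΘe⟩ := swap_poly Ψ hΨ
    obtain ⟨μ, hμ⟩ := MvPolynomial.ne_zero_iff.mp hΘ
    let L := AlgebraicClosure (FractionRing R)
    let ι : R →ₐ[ℂ] L := (IsScalarTower.toAlgHom ℂ (FractionRing R) L).comp (IsScalarTower.toAlgHom ℂ R (FractionRing R))
    have hι : Function.Injective ι :=
      (algebraMap (FractionRing R) L).injective.comp (IsFractionRing.injective R (FractionRing R))
    obtain ⟨F, _, _, θ, x, h1, h2, h3, h4, h5⟩ := step_L hd fa fb ga gb S J w hS hf hg hmax ι hι σ hJ hw i hi _ hμ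
    obtain ⟨T, hT⟩ := (inferInstance : Algebra.FiniteType ℂ R)
    let G : Set F := (θ '' T) ∪ {x}
    have hG : G.Finite := (T.finite_toSet.image θ).union (Set.toFinite _)
    let A : Subalgebra ℂ F := Algebra.adjoin ℂ G
    have hAft : Algebra.FiniteType ℂ A := (Subalgebra.fg_iff_finiteType A).mp ⟨hG.toFinset, by simp [A]⟩
    have hθA : ∀ r, θ r ∈ A := by
      intro r
      have h1 : (⊤ : Subalgebra ℂ R).map θ ≤ A := by
        rw [← hT, AlgHom.map_adjoin]
        exact Algebra.adjoin_mono Set.subset_union_left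
      exact h1 ⟨r, trivial, rfl⟩
    let θA : R →ₐ[ℂ] A := θ.codRestrict A hθA
    let xA : A := ⟨x, Algebra.subset_adjoin (Or.inr rfl)⟩
    let σA : Fin N → A := fun i => θA (σ i)
    have hev : ∀ p : MvPolynomial (Fin N) ℂ, aeval σA p = θA (aeval σ p) := by
      intro p
      rw [← AlgHom.comp_apply, comp_aeval]
    have hπv : ((Polynomial.eval₂ θA.toRingHom xA (coeff μ Θ) : A) : F) = Polynomial.eval₂ θ.toRingHom x (coeff μ Θ) := by
      have : A.val.toRingHom (Polynomial.eval₂ θA.toRingHom xA (coeff μ Θ)) = _ := Polynomial.hom_eval₂ _ _ _ _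
      exact this
    let Ψ' : MvPolynomial (Fin l) A := map (Polynomial.eval₂RingHom θA.toRingHom xA) Θ
    have hΨ' : Ψ' ≠ 0 := by
      rw [MvPolynomial.ne_zero_iff]
      refine ⟨μ, ?_⟩
      intro h
      apply h5
      rw [← hπv]
      rw [coeff_map] at h
      exact congrArg Subtype.val h
    have hcfA : ∀ (a : Fin (d + 1) → MvPolynomial (Fin N) ℂ), (fun i => A.val.toRingHom (cf a σA i)) = cf a (fun i => θ (σ i)) :=
      fun a => cf_map a σA A.val
    have hpre : ∀ (a b : Fin (d + 1) → MvPolynomial (Fin N) ℂ),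
        PreV (cf a (fun i => θ (σ i))) (cf b (fun i => θ (σ i))) ![x, 1] → PreV (cf a σA) (cf b σA) ![xA, 1] := by
      intro a b h
      apply PreV_of_map _ _ A.val.toRingHom Subtype.val_injective
      rw [hcfA, hcfA]
      convert h using 1
      ext i; fin_cases i <;> rfl
    obtain ⟨χ, hχ, z, hz, hΨz⟩ := ih (R := A) σA (fun p hp => by rw [hev, hJ p hp, map_zero])
      (by rw [hev]; exact fun h => h1 (congrArg Subtype.val h)) (fun j => i j.succ)
      (AlgebraicIndependent.of_comp A.val h2) Ψ' hΨ'
    have hpre2 : ∀ (a b : Fin (d + 1) → MvPolynomial (Fin N) ℂ),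
        PreV (cf a σA) (cf b σA) ![xA, 1] → PreV (cf a (fun i => χ (σA i))) (cf b (fun i => χ (σA i))) ![χ xA, 1] := by
      intro a b h
      have h := PreV_map _ _ χ.toRingHom _ h
      have ha : (fun i => χ.toRingHom (cf a σA i)) = cf a (fun i => χ (σA i)) := cf_map a σA χ
      have hb : (fun i => χ.toRingHom (cf b σA i)) = cf b (fun i => χ (σA i)) := cf_map b σA χ
      rw [ha, hb] at h
      convert h using 1
      ext i; fin_cases i <;> simp
    refine ⟨χ.comp θA, ?_, Fin.cons (χ xA) z, ?_, ?_⟩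
    · rw [hev] at hχ; exact hχ
    · intro j
      refine Fin.cases ?_ (fun j => ?_) j
      · exact ⟨hpre2 _ _ (hpre _ _ h3), hpre2 _ _ (hpre _ _ h4)⟩
      · exact hz j
    · rw [← hΘe]
      have hcomp : χ.toRingHom.comp (Polynomial.eval₂RingHom θA.toRingHom xA) =
          Polynomial.eval₂RingHom (χ.comp θA).toRingHom (χ xA) := by
        apply Polynomial.ringHom_ext
        · intro r; simp
        · simp
      have h6 : eval₂ χ.toRingHom z Ψ' = eval₂ (χ.toRingHom.comp (Polynomial.eval₂RingHom θA.toRingHom xA)) z Θ :=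
        eval₂_map _ _ _ _
      rw [h6, hcomp] at hΨz
      exact hΨz

theorem pick_coords {N m : ℕ} (D : (Fin m → ℂ) →L[ℂ] (Fin N → ℂ)) (hD : Function.Injective D) :
    ∃ i : Fin m → Fin N, Function.Surjective (fun v : Fin m → ℂ => fun j => D v (i j)) := by
  classical
  let M : Matrix (Fin N) (Fin m) ℂ := LinearMap.toMatrix' (D : (Fin m → ℂ) →ₗ[ℂ] (Fin N → ℂ))
  have hM : ∀ v, M.mulVec v = D v := fun v => by
    simp only [M]
    rw [← Matrix.toLin'_apply, Matrix.toLin'_toMatrix']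
    rfl
  have hrank : M.rank = m := by
    have h1 : Function.Injective M.mulVecLin := by
      intro v w h
      apply hD
      rw [← hM, ← hM]
      exact h
    have := LinearMap.finrank_range_of_inj h1
    simpa [Matrix.rank] using this
  rw [Matrix.rank_eq_finrank_span_row] at hrank
  obtain ⟨f, hf1, -, hf3⟩ := Submodule.exists_fun_fin_finrank_span_eq ℂ (Set.range M.row)
  have key : ∀ n (_ : n = m) (f : Fin n → Fin m → ℂ) (_ : ∀ i, f i ∈ Set.range M.row) (_ : LinearIndependent ℂ f),
      ∃ i : Fin m → Fin N, LinearIndependent ℂ (fun j => M.row (i j)) := by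
    rintro n rfl f h1 h2
    choose i hi using h1
    exact ⟨i, by simpa [hi] using h2⟩
  obtain ⟨i, hi⟩ := key _ hrank f hf1 hf3
  refine ⟨i, ?_⟩
  have hu : IsUnit (M.submatrix i id) := Matrix.linearIndependent_rows_iff_isUnit.mp hi
  intro u
  refine ⟨(M.submatrix i id)⁻¹.mulVec u, ?_⟩
  have h1 : (M.submatrix i id).mulVec ((M.submatrix i id)⁻¹.mulVec u) = u := by
    rw [Matrix.mulVec_mulVec, Matrix.mul_nonsing_inv _ ((Matrix.isUnit_iff_isUnit_det _).mp hu), Matrix.one_mulVec]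
  funext j
  beta_reduce
  rw [← hM]
  exact congrFun h1 j

theorem chart_indep {N m : ℕ} (S : Set (Fin N → ℂ)) (s : Fin N → ℂ) (hs : s ∈ S) (h : SmoothChartAt S m s) :
    ∃ i : Fin m → Fin N, ∀ P : MvPolynomial (Fin m) ℂ, (∀ s ∈ S, eval (fun j => s (i j)) P = 0) → P = 0 := by
  obtain ⟨U, hU, hsU, V, φ, hV, hφ, -, himg, hder, -⟩ := h
  have : s ∈ φ '' V := by rw [himg]; exact ⟨hs, hsU⟩
  obtain ⟨v0, hv0, rfl⟩ := this
  obtain ⟨i, hi⟩ := pick_coords (fderiv ℂ φ v0) (hder v0 hv0)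
  refine ⟨i, fun P hP => ?_⟩
  let pr : (Fin N → ℂ) →L[ℂ] (Fin m → ℂ) := ContinuousLinearMap.pi fun j => ContinuousLinearMap.proj (i j)
  have hst : HasStrictFDerivAt (fun v => pr (φ v)) (pr.comp (fderiv ℂ φ v0)) v0 :=
    pr.hasStrictFDerivAt.comp v0 (hφ v0 hv0).hasStrictFDerivAt
  have hmap := hst.map_nhds_eq_of_surj (LinearMap.range_eq_top.mpr hi)
  have hmem : (fun v => pr (φ v)) '' V ∈ nhds (pr (φ v0)) := by
    rw [← hmap]
    exact Filter.image_mem_map (hV.mem_nhds hv0)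
  obtain ⟨ε, hε, hball⟩ := Metric.mem_nhds_iff.mp hmem
  refine MvPolynomial.funext_set (q := 0) (fun j => Metric.ball (pr (φ v0) j) ε) (fun j => ?_) ?_
  · exact infinite_of_mem_nhds _ (Metric.ball_mem_nhds _ hε)
  · intro x hx
    have hx' : x ∈ Metric.ball (pr (φ v0)) ε := by
      rw [ball_pi _ hε]; exact hx
    obtain ⟨v, hv, rfl⟩ := hball hx'
    rw [map_zero]
    have hvS : φ v ∈ S := by
      have : φ v ∈ S ∩ U := by rw [← himg]; exact ⟨v, hv, rfl⟩
      exact this.1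
    exact hP _ hvS

theorem cf_eq {N d : ℕ} (A : Fin (d + 1) → MvPolynomial (Fin N) ℂ) (s : Fin N → ℂ) :
    cf A s = fun j => eval s (A j) := by
  funext j
  simp only [cf, aeval_eq_eval]

theorem good_conv {d : ℕ} {a b : Fin (d + 1) → ℂ} (h : GoodPair a b) : GoodV a b := by
  intro v hv hz
  rcases h v hv with h | h
  · exact h (congrFun hz 0)
  · exact h (congrFun hz 1)

theorem mk_eq_wdg {v w : Fin 2 → ℂ} (hv : v ≠ 0) (hw : w ≠ 0) (h : wdg v w = 0) :
    (Projectivization.mk ℂ v hv : P1) = Projectivization.mk ℂ w hw := by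
  obtain ⟨c, hc, rfl⟩ := wdg_eq_zero' hv hw h
  rw [Projectivization.mk_eq_mk_iff]
  exact ⟨(Units.mk0 c hc)⁻¹, by
    rw [inv_smul_eq_iff]; rfl⟩

theorem rep_wdg {v : Fin 2 → ℂ} (hv : v ≠ 0) : wdg v (Projectivization.mk ℂ v hv : P1).rep = 0 := by
  obtain ⟨a, ha⟩ := Projectivization.exists_smul_eq_mk_rep ℂ v hv
  rw [← ha]
  change wdg v ((a : ℂ) • v) = 0
  rw [wdg_smul_right, wdg_self, mul_zero]

theorem ratFun_mk {d : ℕ} (hd : d ≠ 0) {a b : Fin (d + 1) → ℂ} (hg : GoodV a b) {v : Fin 2 → ℂ} (hv : v ≠ 0) :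
    ratFun a b (Projectivization.mk ℂ v hv) = Projectivization.mk ℂ (GG a b v) (hg v hv) := by
  have hne := hg _ (Projectivization.mk ℂ v hv : P1).rep_nonzero
  have h : homEval a (Projectivization.mk ℂ v hv : P1).rep ≠ 0 ∨ homEval b (Projectivization.mk ℂ v hv : P1).rep ≠ 0 := by
    by_contra hc
    push Not at hc
    apply hne
    ext i
    fin_cases i
    · exact hc.1
    · exact hc.2
  unfold ratFun
  rw [dif_pos h]
  apply mk_eq_wdg
  have := GG_wdg a b hd (rep_wdg hv)
  rw [wdg_swap] at this
  exact neg_eq_zero.mp this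

theorem mobius_mk (M : (Fin 2 → ℂ) ≃ₗ[ℂ] (Fin 2 → ℂ)) {v : Fin 2 → ℂ} (hv : v ≠ 0) :
    mobius M (Projectivization.mk ℂ v hv) = Projectivization.mk ℂ (M v) ((LinearEquiv.map_ne_zero_iff M).mpr hv) := by
  unfold mobius
  apply mk_eq_wdg
  obtain ⟨c, hc⟩ := wdg_eq_zero hv (rep_wdg hv)
  rw [hc, map_smul, wdg_smul_left, wdg_self, mul_zero]

theorem iter_mk {d : ℕ} (hd : d ≠ 0) {a b : Fin (d + 1) → ℂ} (hg : GoodV a b) {v : Fin 2 → ℂ} (hv : v ≠ 0) (n : ℕ) :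
    (ratFun a b)^[n] (Projectivization.mk ℂ v hv) = Projectivization.mk ℂ ((GG a b)^[n] v) (iter_ne_zero a b hg hv n) := by
  induction n with
  | zero => rfl
  | succ n ih =>
    rw [Function.iterate_succ_apply', ih, ratFun_mk hd hg]
    congr 1
    rw [Function.iterate_succ_apply']

theorem pre_conv {N d : ℕ} (hd : d ≠ 0) (A B : Fin (d + 1) → MvPolynomial (Fin N) ℂ) (s : Fin N → ℂ)
    (hg : GoodV (cf A s) (cf B s)) {v : Fin 2 → ℂ} (hv : v ≠ 0) (h : PreV (cf A s) (cf B s) v) :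
    (Projectivization.mk ℂ v hv : P1) ∈ famPreper A B s := by
  obtain ⟨n, m, hnm, h⟩ := h
  refine ⟨n, m, hnm, ?_⟩
  unfold famMap
  rw [← cf_eq, ← cf_eq, iter_mk hd hg hv, iter_mk hd hg hv]
  exact mk_eq_wdg _ _ h

theorem conj_conv {N d : ℕ} (hd : d ≠ 0) (A B : Fin (d + 1) → MvPolynomial (Fin N) ℂ) (s s₀ : Fin N → ℂ)
    (hg : GoodV (cf A s) (cf B s)) (hg0 : GoodV (cf A s₀) (cf B s₀)) (M : (Fin 2 → ℂ) ≃ₗ[ℂ] (Fin 2 → ℂ))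
    (h : ConjV (cf A s₀) (cf B s₀) (cf A s) (cf B s) M) :
    famMap A B s = mobius M ∘ famMap A B s₀ ∘ mobius M.symm := by
  funext x
  obtain ⟨u, hu, rfl⟩ : ∃ u hu, x = Projectivization.mk ℂ u hu := ⟨x.rep, x.rep_nonzero, x.mk_rep.symm⟩
  simp only [Function.comp_apply]
  unfold famMap
  rw [← cf_eq, ← cf_eq, ← cf_eq, ← cf_eq, mobius_mk, ratFun_mk hd hg, ratFun_mk hd hg0, mobius_mk]
  apply mk_eq_wdg
  have := h (M.symm u)
  rw [LinearEquiv.apply_symm_apply, wdg_swap] at this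
  exact neg_eq_zero.mp this

theorem scale_eval {N l : ℕ} (Φ : MvPolynomial (Sum (Fin N) (Fin l × Fin 2)) ℂ) (hΦ : MultiHomog Φ) :
    ∃ h : Fin l → ℕ, ∀ (s : Fin N → ℂ) (x : Fin l × Fin 2 → ℂ) (c : Fin l → ℂ),
      eval (Sum.elim s (fun q => c q.1 * x q)) Φ = (∏ i, c i ^ h i) * eval (Sum.elim s x) Φ := by
  choose h hh using hΦ
  refine ⟨h, fun s x c => ?_⟩
  rw [eval_eq', eval_eq', Finset.mul_sum]
  refine Finset.sum_congr rfl fun mo hmo => ?_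
  rw [Fintype.prod_sum_type, Fintype.prod_sum_type, Fintype.prod_prod_type, Fintype.prod_prod_type]
  simp only [Sum.elim_inl, Sum.elim_inr, Fin.prod_univ_two, mul_pow]
  have : ∏ i, (c i ^ mo (Sum.inr (i, 0)) * x (i, 0) ^ mo (Sum.inr (i, 0)) * (c i ^ mo (Sum.inr (i, 1)) * x (i, 1) ^ mo (Sum.inr (i, 1))))
      = (∏ i, c i ^ h i) * ∏ i, (x (i, 0) ^ mo (Sum.inr (i, 0)) * x (i, 1) ^ mo (Sum.inr (i, 1))) := by
    rw [← Finset.prod_mul_distrib]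
    refine Finset.prod_congr rfl fun i _ => ?_
    rw [← hh i mo hmo, pow_add]
    ring
  rw [this]
  ring

/-- vanishing on the standard chart forces vanishing everywhere -/
theorem chart_zero {N l : ℕ} (Φ : MvPolynomial (Sum (Fin N) (Fin l × Fin 2)) ℂ) (hΦ : MultiHomog Φ)
    (s : Fin N → ℂ) (h : ∀ z : Fin l → ℂ, eval (Sum.elim s (fun q => (![z q.1, 1] : Fin 2 → ℂ) q.2)) Φ = 0)
    (x : Fin l × Fin 2 → ℂ) : eval (Sum.elim s x) Φ = 0 := by
  obtain ⟨e, he⟩ := scale_eval Φ hΦ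
  let P : MvPolynomial (Fin l × Fin 2) ℂ := aeval (Sum.elim (fun n => C (s n)) X) Φ
  have hP : ∀ x, eval x P = eval (Sum.elim s x) Φ := by
    intro x
    have h1 : (aeval x).comp (aeval (Sum.elim (fun n => C (s n)) X)) = (aeval (Sum.elim s x) : MvPolynomial (Sum (Fin N) (Fin l × Fin 2)) ℂ →ₐ[ℂ] ℂ) := by
      apply algHom_ext
      rintro (n | q) <;> simp
    have h2 := DFunLike.congr_fun h1 Φ
    simpa [aeval_eq_eval, P] using h2
  have hP0 : P = 0 := by
    refine MvPolynomial.funext_set (q := 0) (fun q => if q.2 = 1 then {0}ᶜ else Set.univ) ?_ ?_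
    · intro q
      by_cases hq : q.2 = 1
      · simp only [hq, if_true]
        exact (Set.finite_singleton (0 : ℂ)).infinite_compl
      · simp only [hq, if_false]
        exact Set.infinite_univ
    · intro x hx
      rw [map_zero, hP]
      have hx1 : ∀ i, x (i, 1) ≠ 0 := by
        intro i
        have := hx (i, 1) trivial
        simpa using this
      have h3 := he s (fun q => (![x (q.1, 0) / x (q.1, 1), 1] : Fin 2 → ℂ) q.2) (fun i => x (i, 1))
      rw [h (fun i => x (i, 0) / x (i, 1)), mul_zero] at h3
      rw [← h3]
      congr 2
      congr 1
      funext q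
      obtain ⟨i, j⟩ := q
      fin_cases j
      · simp only [Fin.zero_eta, Matrix.cons_val_zero]
        field_simp [hx1 i]
      · simp
  rw [← hP, hP0, map_zero]

theorem zar_one {N : ℕ} (p : MvPolynomial (Fin N) ℂ) : ZarClosedAff {s | eval s p = 0} :=
  ⟨{p}, by simp⟩

theorem van_prime {N : ℕ} (S : Set (Fin N → ℂ)) (h : ZarIrreducible S) : (vanishingIdeal ℂ S).IsPrime := by
  obtain ⟨⟨s0, hs0⟩, h⟩ := h
  refine ⟨?_, ?_⟩
  · rw [Ideal.ne_top_iff_one, mem_vanishingIdeal_iff]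
    intro h1
    simpa using h1 s0 hs0
  · intro p q hpq
    rw [mem_vanishingIdeal_iff] at hpq
    rcases h _ _ (zar_one p) (zar_one q) (fun s hs => by
      have := hpq s hs
      rw [map_mul, aeval_eq_eval] at this
      exact mul_eq_zero.mp this) with h1 | h1
    · left
      rw [mem_vanishingIdeal_iff]
      intro s hs
      rw [aeval_eq_eval]
      exact h1 hs
    · right
      rw [mem_vanishingIdeal_iff]
      intro s hs
      rw [aeval_eq_eval]
      exact h1 hs


/-- For a maximally non-isotrivial algebraic family `(f, g)` of pairs of degree-`d`
rational maps over a smooth irreducible Zariski-locally-closed base `S ⊆ ℂ^N` of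
dimension `m ≥ 1`, and any `1 ≤ ℓ ≤ m`, the tuples `(s, x₁, …, x_ℓ)` with each `xᵢ`
preperiodic for both `f_s` and `g_s` are Zariski dense in `S × (ℙ¹(ℂ))^ℓ`. -/
theorem statement2 {N m d ℓ : ℕ} (hm : 1 ≤ m) (hd : 2 ≤ d) (hℓ1 : 1 ≤ ℓ) (hℓm : ℓ ≤ m)
    (S : Set (Fin N → ℂ))
    (hlc : ZarLocallyClosed S) (hirr : ZarIrreducible S) (hsm : SmoothOfDim S m)
    (fa fb ga gb : Fin (d + 1) → MvPolynomial (Fin N) ℂ)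
    (hf : ∀ s ∈ S, GoodPair (fun j => eval s (fa j)) (fun j => eval s (fb j)))
    (hg : ∀ s ∈ S, GoodPair (fun j => eval s (ga j)) (fun j => eval s (gb j)))
    (hmax : ∀ s₀ ∈ S, Set.Finite {s | s ∈ S ∧
      ∃ M : (Fin 2 → ℂ) ≃ₗ[ℂ] (Fin 2 → ℂ),
        famMap fa fb s = mobius M ∘ famMap fa fb s₀ ∘ mobius M.symm ∧
        famMap ga gb s = mobius M ∘ famMap ga gb s₀ ∘ mobius M.symm}) :
    ZarDenseIn S {p : (Fin N → ℂ) × (Fin ℓ → P1) | p.1 ∈ S ∧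
      ∀ i : Fin ℓ, p.2 i ∈ famPreper fa fb p.1 ∩ famPreper ga gb p.1} := by
  have hd0 : d ≠ 0 := by omega
  have hf' : ∀ s ∈ S, GoodV (cf fa s) (cf fb s) := fun s hs => by
    rw [cf_eq, cf_eq]; exact good_conv (hf s hs)
  have hg' : ∀ s ∈ S, GoodV (cf ga s) (cf gb s) := fun s hs => by
    rw [cf_eq, cf_eq]; exact good_conv (hg s hs)
  have hmax' : ∀ s₀ ∈ S, Set.Finite {s | s ∈ S ∧ ∃ M : (Fin 2 → ℂ) ≃ₗ[ℂ] (Fin 2 → ℂ),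
      ConjV (cf fa s₀) (cf fb s₀) (cf fa s) (cf fb s) M ∧ ConjV (cf ga s₀) (cf gb s₀) (cf ga s) (cf gb s) M} := by
    intro s₀ hs₀
    refine (hmax s₀ hs₀).subset ?_
    rintro s ⟨hs, M, h1, h2⟩
    exact ⟨hs, M, conj_conv hd0 fa fb s s₀ (hf' s hs) (hf' s₀ hs₀) M h1,
      conj_conv hd0 ga gb s s₀ (hg' s hs) (hg' s₀ hs₀) M h2⟩
  obtain ⟨s0, hs0⟩ := hirr.1
  obtain ⟨Z, W, ⟨J, hZ⟩, ⟨K, hW⟩, hSZ⟩ := hlc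
  have hs0W : s0 ∉ W := by rw [hSZ] at hs0; exact hs0.2
  have : ∃ w ∈ K, eval s0 w ≠ 0 := by
    by_contra hc
    push Not at hc
    apply hs0W
    rw [hW]
    exact hc
  obtain ⟨w, hwK, hw0⟩ := this
  have hS : ∀ s : Fin N → ℂ, (∀ p ∈ (J : Set (MvPolynomial (Fin N) ℂ)), aeval s p = 0) → aeval s w ≠ 0 → s ∈ S := by
    intro s h1 h2
    rw [aeval_eq_eval] at h1 h2
    rw [hSZ, hZ, hW]
    exact ⟨fun p hp => h1 p hp, fun h => h2 (h w hwK)⟩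
  have hprime := van_prime S hirr
  let I := vanishingIdeal ℂ S
  let A := MvPolynomial (Fin N) ℂ ⧸ I
  let σ : Fin N → A := fun n => Ideal.Quotient.mkₐ ℂ I (X n)
  have hσ : ∀ p : MvPolynomial (Fin N) ℂ, aeval σ p = Ideal.Quotient.mkₐ ℂ I p := by
    intro p
    exact (DFunLike.congr_fun (MvPolynomial.aeval_unique (Ideal.Quotient.mkₐ ℂ I)) p).symm
  have hmk : ∀ p : MvPolynomial (Fin N) ℂ, Ideal.Quotient.mkₐ ℂ I p = 0 ↔ ∀ s ∈ S, eval s p = 0 := by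
    intro p
    rw [Ideal.Quotient.mkₐ_eq_mk, Ideal.Quotient.eq_zero_iff_mem, mem_vanishingIdeal_iff]
    simp only [aeval_eq_eval]
  have hσJ : ∀ p ∈ (J : Set (MvPolynomial (Fin N) ℂ)), aeval σ p = 0 := by
    intro p hp
    rw [hσ, hmk]
    intro s hs
    rw [hSZ, hZ] at hs
    exact hs.1 p hp
  have hσw : aeval σ w ≠ 0 := by
    rw [hσ]
    intro h
    exact hw0 ((hmk w).mp h s0 hs0)
  obtain ⟨i, hi⟩ := chart_indep S s0 hs0 (hsm s0 hs0)
  have hind : AlgebraicIndependent ℂ (fun j => σ (i j)) := by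
    rw [algebraicIndependent_iff]
    intro P hP
    apply hi P
    have h1 : aeval (fun j => σ (i j)) P = Ideal.Quotient.mkₐ ℂ I (rename i P) := by
      rw [← hσ, aeval_rename]; rfl
    rw [h1, hmk] at hP
    intro s hs
    have := hP s hs
    rwa [eval_rename] at this
  have hind' : AlgebraicIndependent ℂ (fun j : Fin ℓ => σ (i (Fin.castLE hℓm j))) :=
    hind.comp (Fin.castLE hℓm) (Fin.castLE_injective hℓm)
  rintro Zc ⟨Fs, hhom, rfl⟩ hT p hp
  by_contra hpZ
  simp only [Set.mem_ofPred_eq] at hpZ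
  push Not at hpZ
  obtain ⟨Φ, hΦ, hΦp⟩ := hpZ
  let κ : Sum (Fin N) (Fin ℓ × Fin 2) → MvPolynomial (Fin ℓ) A :=
    Sum.elim (fun n => C (σ n)) (fun q => (![X q.1, 1] : Fin 2 → MvPolynomial (Fin ℓ) A) q.2)
  let Ψ : MvPolynomial (Fin ℓ) A := aeval κ Φ
  have hev : ∀ (χ : A →ₐ[ℂ] ℂ) (z : Fin ℓ → ℂ), eval₂ χ.toRingHom z Ψ =
      eval (Sum.elim (fun n => χ (σ n)) (fun q => (![z q.1, 1] : Fin 2 → ℂ) q.2)) Φ := by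
    intro χ z
    have h1 : (eval₂Hom χ.toRingHom z).comp (aeval κ).toRingHom =
        (eval (Sum.elim (fun n => χ (σ n)) (fun q => (![z q.1, 1] : Fin 2 → ℂ) q.2))) := by
      apply MvPolynomial.ringHom_ext
      · intro r
        simp [MvPolynomial.algebraMap_apply]
      · rintro (n | ⟨i, j⟩)
        · simp [κ]
        · fin_cases j <;> simp [κ]
    exact DFunLike.congr_fun h1 Φ
  have hΨ : Ψ ≠ 0 := by
    intro h0
    let χ : A →ₐ[ℂ] ℂ := Ideal.Quotient.liftₐ I (aeval p.1) (fun a ha => mem_vanishingIdeal_iff.mp ha p.1 hp)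
    have hχ : (fun n => χ (σ n)) = p.1 := by
      funext n
      have : χ (σ n) = aeval p.1 (X n) := Ideal.Quotient.liftₐ_apply _ _ _ _
      rw [this, aeval_X]
    apply hΦp
    refine chart_zero Φ (hhom Φ hΦ) p.1 ?_ _
    intro z
    have := hev χ z
    rw [h0, hχ] at this
    rw [← this]
    simp
  obtain ⟨χ, hχw, z, hz, hΨz⟩ := Q_thm hd fa fb ga gb S J w hS hf' hg' hmax' ℓ σ hσJ hσw _ hind' Ψ hΨ
  rw [hev] at hΨz
  have hχe : ∀ p : MvPolynomial (Fin N) ℂ, aeval (fun n => χ (σ n)) p = χ (aeval σ p) := by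
    intro p
    rw [← AlgHom.comp_apply, comp_aeval]
  have hsS : (fun n => χ (σ n)) ∈ S := by
    apply hS
    · intro p hp
      rw [hχe, hσJ p hp, map_zero]
    · rw [hχe]; exact hχw
  have hmem := hT (a := (fun n => χ (σ n), fun j => toP1 (z j))) ⟨hsS, fun j =>
    ⟨pre_conv hd0 fa fb _ (hf' _ hsS) _ (hz j).1, pre_conv hd0 ga gb _ (hg' _ hsS) _ (hz j).2⟩⟩
  have h0 := hmem Φ hΦ
  have hc : ∀ j, ∃ c : ℂ, c ≠ 0 ∧ (toP1 (z j)).rep = c • ![z j, 1] := fun j =>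
    wdg_eq_zero' vec_one_ne (toP1 (z j)).rep_nonzero (rep_wdg _)
  choose c hc0 hc using hc
  obtain ⟨e, he⟩ := scale_eval Φ (hhom Φ hΦ)
  have h1 := he (fun n => χ (σ n)) (fun q => (![z q.1, 1] : Fin 2 → ℂ) q.2) c
  have h2 : ambEval ((fun n => χ (σ n), fun j => toP1 (z j)) : (Fin N → ℂ) × (Fin ℓ → P1)) =
      Sum.elim (fun n => χ (σ n)) (fun q => c q.1 * (![z q.1, 1] : Fin 2 → ℂ) q.2) := by
    unfold ambEval
    congr 1
    funext q
    change (toP1 (z q.1)).rep q.2 = _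
    rw [hc]; rfl
  rw [h2, h1] at h0
  rcases mul_eq_zero.mp h0 with h3 | h3
  · rw [Finset.prod_eq_zero_iff] at h3
    obtain ⟨j, -, hj⟩ := h3
    exact pow_ne_zero _ (hc0 j) hj
  · exact hΨz h3
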